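/- arXiv:1808.02295 — 3 statements merged into one kernel-verified Lean document; each statement's English description precedes it below -/
import Mathlib

section
/- Let K be a real-symmetric compact subset of ℂ with ℂ \ K connected, and let f be a real-symmetric function continuous on K and holomorphic on the interior of K. Then for every ε > 0 there exists a real-symmetric algebraic polynomial P such that |f(z) − P(z)| < ε for all z ∈ K. -/
open Complex Set

namespace Mergelyan

open Filter Topology Metric MeasureTheory
open Real (circleAverage)

/-- The uniform closure of the polynomials in `C(K, ℂ)`. -/
noncomputable def polyClosure (K : Set ℂ) [CompactSpace K] : Subalgebra ℂ C(K, ℂ) :=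
  (polynomialFunctions K).topologicalClosure

variable {K : Set ℂ}

theorem exists_id_mem_polyClosure [CompactSpace K] :
    ∃ u ∈ polyClosure K, ∀ z : K, u z = z := by
  refine ⟨Polynomial.toContinuousMapOn Polynomial.X K, ?_, fun z => by simp⟩
  apply Subalgebra.le_topologicalClosure
  exact ⟨Polynomial.X, trivial, rfl⟩

theorem exists_const_mem_polyClosure [CompactSpace K] (c : ℂ) :
    ∃ u ∈ polyClosure K, ∀ z : K, u z = c :=
  ⟨algebraMap ℂ C(K, ℂ) c, (polyClosure K).algebraMap_mem c, fun z => by simp⟩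

theorem exists_comp_mem_polyClosure [CompactSpace K] {φ : ℂ → ℂ}
    (hφ : DifferentiableOn ℂ φ (ball 0 1)) {v : C(K, ℂ)} (hv : v ∈ polyClosure K) {ρ : ℝ}
    (hρ : ρ < 1) (hvρ : ∀ z, ‖v z‖ ≤ ρ) : ∃ w ∈ polyClosure K, ∀ z, w z = φ (v z) := by
  have hmem : ∀ z, v z ∈ ball (0 : ℂ) 1 := fun z => by
    rw [mem_ball_zero_iff]; exact (hvρ z).trans_lt hρ
  let w : C(K, ℂ) := ⟨fun z => φ (v z), hφ.continuousOn.comp_continuous v.continuous hmem⟩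
  refine ⟨w, ?_, fun z => rfl⟩
  obtain ⟨σ, hσ1, hσ2⟩ := exists_between (max_lt hρ one_pos)
  have hσ0 : 0 < σ := (le_max_right _ _).trans_lt hσ1
  obtain ⟨τ, hτ1, hτ2⟩ := exists_between hσ2
  lift σ to NNReal using hσ0.le
  lift τ to NNReal using (hσ0.trans hτ1).le
  have hps := DifferentiableOn.hasFPowerSeriesOnBall (R := τ) (c := 0) (f := φ)
    (hφ.mono (closedBall_subset_ball hτ2)) (hσ0.trans hτ1)
  have hu := hps.tendstoUniformlyOn (r' := σ) (by exact_mod_cast hτ1)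
  set q := cauchyPowerSeries φ 0 τ
  have hlim : Tendsto (fun n => ∑ k ∈ Finset.range n, q.coeff k • v ^ k) atTop (𝓝 w) := by
    rw [ContinuousMap.tendsto_iff_tendstoUniformly, Metric.tendstoUniformly_iff]
    rw [Metric.tendstoUniformlyOn_iff] at hu
    intro ε hε
    filter_upwards [hu ε hε] with n hn z
    have := hn (v z) (by
      rw [mem_ball_zero_iff]; exact (hvρ z).trans_lt ((le_max_left _ _).trans_lt hσ1))
    simpa [w, FormalMultilinearSeries.partialSum, mul_comm] using this
  refine (Subalgebra.isClosed_topologicalClosure _).mem_of_tendsto hlim (.of_forall fun n => ?_)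
  exact Subalgebra.sum_mem _ fun k _ => Subalgebra.smul_mem _ (Subalgebra.pow_mem _ hv k) _

theorem exists_inv_mem_polyClosure_of_ball [CompactSpace K] {a a' : ℂ} {d : ℝ}
    (hd : ∀ z ∈ K, d ≤ ‖z - a‖) (ha' : ‖a' - a‖ < d)
    (h : ∃ u ∈ polyClosure K, ∀ z : K, u z = ((z : ℂ) - a)⁻¹) :
    ∃ u ∈ polyClosure K, ∀ z : K, u z = ((z : ℂ) - a')⁻¹ := by
  obtain ⟨u, hu, hua⟩ := h
  have hd0 : 0 < d := (norm_nonneg _).trans_lt ha'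
  obtain ⟨w, hw, hwv⟩ := exists_comp_mem_polyClosure (φ := fun x => (1 - x)⁻¹)
    (v := (a' - a) • u) (ρ := ‖a' - a‖ / d) (by
      refine DifferentiableOn.inv (by fun_prop) fun x hx h => ?_
      rw [mem_ball_zero_iff, ← sub_eq_zero.1 h] at hx
      simp at hx) (Subalgebra.smul_mem _ hu _) ((div_lt_one hd0).2 ha') (fun z => by
      have := hd z z.2
      simp only [ContinuousMap.smul_apply, hua, smul_eq_mul, norm_mul, norm_inv]
      rw [div_eq_mul_inv]
      gcongr)
  refine ⟨u * w, Subalgebra.mul_mem _ hu hw, fun z => ?_⟩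
  have h1 := hd z z.2
  have hza : (z : ℂ) - a ≠ 0 := norm_pos_iff.1 (hd0.trans_le h1)
  simp only [ContinuousMap.mul_apply, hwv, hua, ContinuousMap.smul_apply, smul_eq_mul]
  rw [← mul_inv]
  congr 1
  field_simp
  ring

theorem subset_of_ball_step {U V : Set ℂ} (hU : IsOpen U) (hUc : IsPreconnected U)
    (hVU : V ⊆ U) (hV : V.Nonempty)
    (hstep : ∀ a ∈ V, ∀ d ≤ 1, ball a d ⊆ U → ball a d ⊆ V) : U ⊆ V := by
  have hU' : ∀ x ∈ U, ∃ d ≤ 1, 0 < d ∧ ball x d ⊆ U := fun x hx => by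
    obtain ⟨d, hd, h⟩ := Metric.isOpen_iff.1 hU x hx
    exact ⟨min d 1, min_le_right _ _, lt_min hd one_pos,
      (ball_subset_ball (min_le_left _ _)).trans h⟩
  refine hUc.subset_of_closure_inter_subset ?_ (hV.mono fun x hx => ⟨hVU hx, hx⟩) ?_
  · rw [Metric.isOpen_iff]
    intro a ha
    obtain ⟨d, hd1, hd, h⟩ := hU' a (hVU ha)
    exact ⟨d, hd, hstep a ha d hd1 h⟩
  · rintro x ⟨hx, hxU⟩
    obtain ⟨d, hd1, hd, h⟩ := hU' x hxU
    obtain ⟨y, hy, hxy⟩ := Metric.mem_closure_iff.1 hx (d / 2) (by positivity)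
    refine hstep y hy (d / 2) (by linarith) (fun z hz => h ?_) hxy
    rw [mem_ball] at hz ⊢
    linarith [dist_triangle z y x, dist_comm x y]

theorem exists_inv_mem_polyClosure [CompactSpace K] (hK : IsCompact K) (hc : IsConnected Kᶜ)
    {a : ℂ} (ha : a ∉ K) : ∃ u ∈ polyClosure K, ∀ z : K, u z = ((z : ℂ) - a)⁻¹ := by
  obtain ⟨M, hM0, hM⟩ := hK.isBounded.exists_pos_norm_le
  have hbase : ∃ u ∈ polyClosure K, ∀ z : K, u z = ((z : ℂ) - (2 * M : ℝ))⁻¹ := by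
    obtain ⟨u, hu, hu'⟩ := exists_id_mem_polyClosure (K := K)
    obtain ⟨w, hw, hwv⟩ := exists_comp_mem_polyClosure (φ := fun x => (x - 1)⁻¹)
      (v := ((2 * M : ℝ) : ℂ)⁻¹ • u) (ρ := 1 / 2) (by
        refine DifferentiableOn.inv (by fun_prop) fun x hx h => ?_
        rw [mem_ball_zero_iff, sub_eq_zero.1 h] at hx
        simp at hx) (Subalgebra.smul_mem _ hu _) (by norm_num) (fun z => by
        have := hM z z.2
        rw [ContinuousMap.smul_apply, hu', smul_eq_mul, norm_mul, norm_inv, norm_real,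
          Real.norm_of_nonneg (by positivity)]
        field_simp
        linarith)
    refine ⟨((2 * M : ℝ) : ℂ)⁻¹ • w, Subalgebra.smul_mem _ hw _, fun z => ?_⟩
    have : ((2 * M : ℝ) : ℂ) ≠ 0 := by
      rw [Complex.ofReal_ne_zero]; positivity
    simp only [ContinuousMap.smul_apply, smul_eq_mul, hwv, hu']
    rw [← mul_inv]
    congr 1
    field_simp
  refine (subset_of_ball_step
    (V := {a | a ∈ Kᶜ ∧ ∃ u ∈ polyClosure K, ∀ z : K, u z = ((z : ℂ) - a)⁻¹})
    hK.isClosed.isOpen_compl hc.isPreconnected (fun x hx => hx.1) ?_ ?_ ha).2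
  · have : ((2 * M : ℝ) : ℂ) ∈ Kᶜ := fun h => by
      have := hM _ h
      rw [norm_real, Real.norm_eq_abs, abs_of_pos (by positivity)] at this
      linarith
    exact ⟨_, this, hbase⟩
  · rintro b ⟨hb, hb'⟩ d - hd b' hb''
    refine ⟨hd hb'', exists_inv_mem_polyClosure_of_ball (d := d) (fun z hz => ?_)
      (by rwa [mem_ball, dist_eq_norm] at hb'') hb'⟩
    by_contra! h
    exact hd (by rwa [mem_ball, dist_eq_norm] : z ∈ ball b d) hz

theorem one_sub_re_pos {w : ℂ} (hw : ‖w‖ < 1) : 0 < (1 - w).re := by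
  have := (re_le_norm w).trans_lt hw
  simpa using this

theorem mul_re_pos {x y : ℂ} (hx : 0 < x.re) (hx2 : 0 < (x ^ 2).re) (hy : 0 < y.re)
    (hy2 : 0 < (y ^ 2).re) : 0 < (x * y).re := by
  simp only [pow_two, mul_re] at *
  have h1 : |x.im| < x.re := abs_lt_of_sq_lt_sq (by nlinarith) hx.le
  have h2 : |y.im| < y.re := abs_lt_of_sq_lt_sq (by nlinarith) hy.le
  have : x.im * y.im ≤ |x.im| * |y.im| := by rw [← abs_mul]; exact le_abs_self _
  nlinarith [abs_nonneg x.im, abs_nonneg y.im]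

theorem cpow_half_sq (w : ℂ) : (w ^ (1 / 2 : ℂ)) ^ 2 = w := by
  rw [one_div]; exact Complex.cpow_nat_inv_pow w two_ne_zero

theorem cpow_half_re_pos {w : ℂ} (hw : 0 < w.re) : 0 < (w ^ (1 / 2 : ℂ)).re := by
  have hw0 : w ≠ 0 := fun h => by simp [h] at hw
  rw [cpow_def_of_ne_zero hw0, exp_re]
  have h := abs_arg_lt_pi_div_two_iff.2 (Or.inl hw)
  have h2 : (Complex.log w * (1 / 2)).im = w.arg / 2 := by
    simp [Complex.mul_im, Complex.log_im, div_eq_mul_inv]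
  rw [h2]
  refine mul_pos (Real.exp_pos _) (Real.cos_pos_of_mem_Ioo ?_)
  rw [abs_lt] at h
  constructor <;> linarith [Real.pi_pos]

theorem exists_sqrt_mem_polyClosure [CompactSpace K] (hK : IsCompact K) (hc : IsConnected Kᶜ)
    {a : ℂ} (ha : a ∉ K) : ∃ b : ℂ, 1 ≤ ‖b - a‖ ∧ ‖b - a‖ < 2 ∧ ∃ s ∈ polyClosure K, ∀ z : K,
      s z ^ 2 * (z - a) = z - b ∧ (2 ≤ ‖(z : ℂ) - a‖ → 0 < (s z).re) := by
  by_contra! hcon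
  let V : Set ℂ := {b | b ∈ Kᶜ ∧ ‖b - a‖ < 2 ∧ ∃ s ∈ polyClosure K, ∀ z : K,
      s z ^ 2 * (z - a) = z - b ∧ (2 ≤ ‖(z : ℂ) - a‖ → 0 < (s z).re)}
  have hV : ∀ b ∈ V, ‖b - a‖ < 1 := by
    rintro b ⟨-, h2, s, hs, h⟩
    by_contra! h1
    obtain ⟨z, hz⟩ := hcon b h1 h2 s hs
    exact (hz (h z).1).2.not_gt ((h z).2 (hz (h z).1).1)
  have hane : ∀ z : K, (z : ℂ) - a ≠ 0 := fun z h => ha (sub_eq_zero.1 h ▸ z.2)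
  have key : Kᶜ ⊆ V := by
    refine subset_of_ball_step hK.isClosed.isOpen_compl hc.isPreconnected (fun b hb => hb.1)
      ⟨a, ha, by simp, 1, Subalgebra.one_mem _, fun z => by simp⟩ fun b hb d hd1 hd b' hb' => ?_
    have hb1 := hV b hb
    obtain ⟨hbK, -, s, hs, hsz⟩ := hb
    rw [mem_ball, dist_eq_norm] at hb'
    have hd0 : 0 < d := (norm_nonneg _).trans_lt hb'
    have hdz : ∀ z : K, d ≤ ‖(z : ℂ) - b‖ := fun z => by
      by_contra! h
      exact hd (by rwa [mem_ball, dist_eq_norm] : (z : ℂ) ∈ ball b d) z.2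
    obtain ⟨u, hu, hub⟩ := exists_inv_mem_polyClosure hK hc hbK
    have hρ : ∀ z, ‖((b' - b) • u) z‖ ≤ ‖b' - b‖ / d := fun z => by
      have := hdz z
      simp only [ContinuousMap.smul_apply, hub, smul_eq_mul, norm_mul, norm_inv]
      rw [div_eq_mul_inv]
      gcongr
    have hρ1 : ‖b' - b‖ / d < 1 := (div_lt_one hd0).2 hb'
    obtain ⟨w, hw, hwv⟩ := exists_comp_mem_polyClosure (φ := fun x => (1 - x) ^ (1 / 2 : ℂ))
      (v := (b' - b) • u) (fun x hx => by
        refine DifferentiableAt.differentiableWithinAt ?_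
        refine DifferentiableAt.cpow_const (by fun_prop) (Or.inl (one_sub_re_pos ?_))
        simpa using hx) (Subalgebra.smul_mem _ hu _) hρ1 hρ
    refine ⟨hd (by rwa [mem_ball, dist_eq_norm]), ?_, s * w, Subalgebra.mul_mem _ hs hw,
      fun z => ⟨?_, fun hz => ?_⟩⟩
    · calc ‖b' - a‖ = ‖(b' - b) + (b - a)‖ := by ring_nf
        _ ≤ ‖b' - b‖ + ‖b - a‖ := norm_add_le _ _
        _ < 2 := by linarith
    · have hzb : (z : ℂ) - b ≠ 0 := norm_pos_iff.1 (hd0.trans_le (hdz z))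
      calc (s * w) z ^ 2 * (z - a) = (s z ^ 2 * (z - a)) * (w z) ^ 2 := by
            rw [ContinuousMap.mul_apply]; ring
        _ = z - b' := by
            rw [(hsz z).1, hwv, cpow_half_sq, ContinuousMap.smul_apply, hub, smul_eq_mul]
            field_simp
            ring
    · have hre := one_sub_re_pos ((hρ z).trans_lt hρ1)
      refine mul_re_pos ((hsz z).2 hz) ?_ ?_ ?_
      · have : s z ^ 2 = 1 - (b - a) / (z - a) := by
          have := hane z
          have h2 := (hsz z).1
          field_simp
          linear_combination h2
        rw [this]
        refine one_sub_re_pos ?_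
        rw [norm_div, div_lt_one (by linarith)]
        linarith
      · rw [hwv]; exact cpow_half_re_pos hre
      · rw [hwv, cpow_half_sq]; exact hre
  refine NormedSpace.unbounded_univ ℂ ℂ ?_
  refine (hK.isBounded.union (isBounded_ball (x := a) (r := 1))).subset fun z _ => ?_
  by_cases hz : z ∈ K
  · exact Or.inl hz
  · exact Or.inr (by rw [mem_ball, dist_eq_norm]; exact hV z (key hz))

/-- The kernel dominating the error of the approximate Cauchy kernels. -/
noncomputable def errorKernel (w : ℂ) : ℝ := 10 ^ 7 * ((‖w‖⁻¹ + 1) * ((1 + ‖w‖) ^ 3)⁻¹)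

section numeric

variable {u s β ξ : ℂ}

/-- The inverse of the Joukowski map of the slit with end points `0` and `β`, up to scaling. -/
noncomputable def slitInv (u s β : ℂ) : ℂ := 8 * (u - β / 2 - u * s) / β ^ 2

theorem slitInv_mul (hβ0 : β ≠ 0) (hs : s ^ 2 * u = u - β) :
    slitInv u s β * (u - β / 2 + u * s) = 2 := by
  unfold slitInv
  field_simp
  linear_combination (-32) * u * hs

theorem half_norm_le_of_re_pos (hβ2 : ‖β‖ < 2) (hu : 2 ≤ ‖u‖) (hre : 0 < s.re) :
    ‖u‖ / 2 ≤ ‖u - β / 2 + u * s‖ := by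
  have h1 : 1 ≤ ‖1 + s‖ := by
    have := re_le_norm (1 + s)
    simp at this
    linarith
  have h2 : ‖u * (1 + s)‖ - ‖β / 2‖ ≤ ‖u * (1 + s) - β / 2‖ := norm_sub_norm_le _ _
  have h3 : ‖u‖ * 1 ≤ ‖u * (1 + s)‖ := by rw [norm_mul]; gcongr
  have h4 : ‖β / 2‖ = ‖β‖ / 2 := by simp
  have h5 : u - β / 2 + u * s = u * (1 + s) - β / 2 := by ring
  rw [h5]
  linarith

theorem norm_slitInv_le (hβ1 : 1 ≤ ‖β‖) (hβ2 : ‖β‖ < 2) (hs : s ^ 2 * u = u - β)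
    (hre : 2 ≤ ‖u‖ → 0 < s.re) : ‖slitInv u s β‖ ≤ 48 := by
  have hβ0 : β ≠ 0 := norm_pos_iff.1 (by linarith)
  rcases lt_or_ge ‖u‖ 2 with hu | hu
  · have h1 : ‖u * s‖ ≤ 3 := by
      have : ‖u * s‖ ^ 2 = ‖u‖ * ‖u - β‖ := by
        rw [← norm_pow, ← norm_mul, ← hs]; ring_nf
      have h2 : ‖u - β‖ ≤ 4 := (norm_sub_le _ _).trans (by linarith)
      nlinarith [norm_nonneg u, norm_nonneg (u * s), norm_nonneg (u - β)]
    have h2 : ‖u - β / 2 - u * s‖ ≤ 6 := by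
      have h3 := norm_sub_le (u - β / 2) (u * s)
      have h4 := norm_sub_le u (β / 2)
      have h5 : ‖β / 2‖ = ‖β‖ / 2 := by simp
      linarith
    rw [slitInv, norm_div, norm_mul, norm_pow]
    have h6 : ‖(8 : ℂ)‖ = 8 := by simp
    rw [h6, div_le_iff₀ (by positivity)]
    nlinarith
  · have h1 := half_norm_le_of_re_pos hβ2 hu (hre hu)
    have h2 := congrArg norm (slitInv_mul hβ0 hs)
    rw [norm_mul] at h2
    have h6 : ‖(2 : ℂ)‖ = 2 := by simp
    rw [h6] at h2
    nlinarith [norm_nonneg (slitInv u s β)]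

theorem norm_slitInv_sub_le (hβ1 : 1 ≤ ‖β‖) (hβ2 : ‖β‖ < 2) (hs : s ^ 2 * u = u - β)
    (hre : 2 ≤ ‖u‖ → 0 < s.re) (hξ : ‖ξ‖ < 2) :
    ‖slitInv u s β + (ξ - β / 2) * slitInv u s β ^ 2 - (u - ξ)⁻¹‖ ≤ errorKernel (u - ξ) := by
  have hβ0 : β ≠ 0 := norm_pos_iff.1 (by linarith)
  have hg := norm_slitInv_le hβ1 hβ2 hs hre
  have hmul := slitInv_mul hβ0 hs
  set g := slitInv u s β
  have hβh : ‖β / 2‖ = ‖β‖ / 2 := by simp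
  have hη : ‖ξ - β / 2‖ ≤ 3 := (norm_sub_le _ _).trans (by linarith)
  set η := ξ - β / 2 with hηdef
  unfold errorKernel
  set t := ‖u - ξ‖ with ht
  have ht0 : 0 ≤ t := norm_nonneg _
  rw [← mul_assoc, ← div_eq_mul_inv, le_div_iff₀ (by positivity)]
  rcases le_or_gt t 8 with h8 | h8
  · have h1 : ‖g + η * g ^ 2 - (u - ξ)⁻¹‖ ≤ 6960 * (t⁻¹ + 1) := by
      have h2 := norm_sub_le (g + η * g ^ 2) (u - ξ)⁻¹
      have h3 := norm_add_le g (η * g ^ 2)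
      have h4 : ‖η * g ^ 2‖ ≤ 3 * 48 ^ 2 := by rw [norm_mul, norm_pow]; gcongr
      rw [norm_inv] at h2
      have : 0 ≤ t⁻¹ := by positivity
      linarith
    have h5 : (1 + t) ^ 3 ≤ (1 + 8) ^ 3 := by gcongr
    calc _ ≤ (6960 * (t⁻¹ + 1)) * (1 + 8) ^ 3 := by gcongr
      _ ≤ _ := by
        have : 0 ≤ t⁻¹ + 1 := by positivity
        nlinarith
  · have hut : 3 / 4 * t ≤ ‖u‖ := by
      have := norm_sub_le u ξ
      linarith
    have hu : 2 ≤ ‖u‖ := by linarith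
    have hp := half_norm_le_of_re_pos hβ2 hu (hre hu)
    have hv : 3 / 8 * t ≤ ‖u - β / 2‖ := by
      have := norm_sub_norm_le u (β / 2)
      linarith
    set v := u - β / 2 with hvdef
    have hp' : 3 / 8 * t ≤ ‖v + u * s‖ := by linarith
    have hv0 : v ≠ 0 := norm_pos_iff.1 (by linarith)
    have hp0 : v + u * s ≠ 0 := norm_pos_iff.1 (by linarith)
    have hw0 : u - ξ ≠ 0 := norm_pos_iff.1 (by linarith)
    have hgeq : g = 2 / (v + u * s) := by rw [eq_div_iff hp0, hmul]
    have he : g - v⁻¹ = (β / 2) ^ 2 / (v * (v + u * s) ^ 2) := by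
      rw [hgeq]
      field_simp
      have : (v - u * s) * (v + u * s) = β ^ 2 / 4 := by
        rw [hvdef]; linear_combination (-u) * hs
      linear_combination 4 * this
    have he' : ‖g - v⁻¹‖ ≤ 19 / t ^ 3 := by
      rw [he, norm_div, norm_mul, norm_pow, norm_pow]
      have hb : ‖β / 2‖ ^ 2 ≤ 1 := by rw [hβh]; nlinarith [norm_nonneg β]
      calc ‖β / 2‖ ^ 2 / (‖v‖ * ‖v + u * s‖ ^ 2) ≤ 1 / ((3 / 8 * t) * (3 / 8 * t) ^ 2) := by gcongr
        _ ≤ 19 / t ^ 3 := by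
          rw [div_le_div_iff₀ (by positivity) (by positivity)]
          nlinarith [pow_pos (by linarith : 0 < t) 3]
    have hvi : ‖v⁻¹‖ ≤ 1 := by
      rw [norm_inv]; exact inv_le_one_of_one_le₀ (by linarith)
    have hid : g + η * g ^ 2 - (u - ξ)⁻¹
        = (g - v⁻¹) * (1 + η * (g + v⁻¹)) - η ^ 2 / (v ^ 2 * (u - ξ)) := by
      have : u - ξ = v - η := by rw [hvdef, hηdef]; ring
      rw [this] at hw0 ⊢
      field_simp
      ring
    have h1 : ‖1 + η * (g + v⁻¹)‖ ≤ 148 := by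
      calc ‖1 + η * (g + v⁻¹)‖ ≤ ‖(1 : ℂ)‖ + ‖η * (g + v⁻¹)‖ := norm_add_le _ _
        _ ≤ 1 + 3 * (48 + 1) := by
          rw [norm_mul, norm_one]
          have := norm_add_le g v⁻¹
          gcongr
          linarith
        _ = 148 := by norm_num
    have h2 : ‖η ^ 2 / (v ^ 2 * (u - ξ))‖ ≤ 64 / t ^ 3 := by
      rw [norm_div, norm_mul, norm_pow, norm_pow, ← ht]
      calc ‖η‖ ^ 2 / (‖v‖ ^ 2 * t) ≤ 3 ^ 2 / ((3 / 8 * t) ^ 2 * t) := by gcongr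
        _ = 64 / t ^ 3 := by field_simp; norm_num
    have h3 : ‖g + η * g ^ 2 - (u - ξ)⁻¹‖ ≤ 3000 / t ^ 3 := by
      rw [hid]
      calc _ ≤ ‖(g - v⁻¹) * (1 + η * (g + v⁻¹))‖ + ‖η ^ 2 / (v ^ 2 * (u - ξ))‖ := norm_sub_le _ _
        _ ≤ 19 / t ^ 3 * 148 + 64 / t ^ 3 := by rw [norm_mul]; gcongr
        _ = 2876 / t ^ 3 := by ring
        _ ≤ 3000 / t ^ 3 := by gcongr; norm_num
    have h4 : (1 + t) ^ 3 ≤ (2 * t) ^ 3 := by gcongr; linarith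
    calc _ ≤ 3000 / t ^ 3 * (2 * t) ^ 3 := by gcongr
      _ = 24000 := by field_simp; norm_num
      _ ≤ 10 ^ 7 * (t⁻¹ + 1) := by
        have : 0 ≤ t⁻¹ := by positivity
        linarith

end numeric

theorem locallyIntegrable_norm_inv : LocallyIntegrable (fun w : ℂ => ‖w‖⁻¹) volume := by
  refine locallyIntegrable_of_norm_le_rpow (C := 1) (α := 1) (by simp) (by simp) ?_ ?_
  · exact .of_forall fun x => by simp [Real.rpow_neg_one]
  · exact (measurable_norm.inv).aestronglyMeasurable

theorem errorKernel_nonneg (w : ℂ) : 0 ≤ errorKernel w := by unfold errorKernel; positivity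

theorem integrable_errorKernel : Integrable errorKernel := by
  have h3 : Integrable fun w : ℂ => ((1 + ‖w‖) ^ 3)⁻¹ := by
    have := integrable_one_add_norm (E := ℂ) (μ := volume) (r := 3) (by simp; norm_num)
    refine this.congr (.of_forall fun w => ?_)
    simp only
    rw [Real.rpow_neg (by positivity)]
    norm_cast
  have hloc : Integrable ((closedBall (0 : ℂ) 1).indicator fun w => ‖w‖⁻¹) :=
    (locallyIntegrable_norm_inv.integrableOn_isCompact
      (isCompact_closedBall 0 1)).integrable_indicator measurableSet_closedBall
  refine Integrable.const_mul ?_ _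
  refine Integrable.mono' (hloc.add (h3.const_mul 2)) ?_ (.of_forall fun w => ?_)
  · exact Measurable.aestronglyMeasurable (by fun_prop)
  · rw [Real.norm_of_nonneg (by positivity)]
    simp only [Pi.add_apply]
    have hle : ((1 + ‖w‖) ^ 3)⁻¹ ≤ 1 := inv_le_one_of_one_le₀ (one_le_pow₀ (by simp))
    have hp : 0 ≤ ((1 + ‖w‖) ^ 3)⁻¹ := by positivity
    have hi : 0 ≤ ‖w‖⁻¹ := by positivity
    by_cases hw : w ∈ closedBall (0 : ℂ) 1
    · rw [indicator_of_mem hw]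
      nlinarith
    · rw [indicator_of_notMem hw]
      have : ‖w‖⁻¹ ≤ 1 := inv_le_one_of_one_le₀ (by simpa using (not_le.1 (by simpa using hw)).le)
      nlinarith


/-- The modulus of the Cauchy kernel, truncated at distance `M`. -/
noncomputable def truncKernel (M : ℝ) : ℂ → ℝ := (closedBall (0 : ℂ) M).indicator fun w => ‖w‖⁻¹

theorem integrable_truncKernel (M : ℝ) : Integrable (truncKernel M) :=
  (locallyIntegrable_norm_inv.integrableOn_isCompact
    (isCompact_closedBall 0 M)).integrable_indicator measurableSet_closedBall

theorem truncKernel_of_le {M : ℝ} {w : ℂ} (hw : ‖w‖ ≤ M) : truncKernel M w = ‖w‖⁻¹ :=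
  indicator_of_mem (by simpa using hw) _

theorem truncKernel_nonneg (M : ℝ) (w : ℂ) : 0 ≤ truncKernel M w :=
  indicator_nonneg (fun _ _ => by positivity) _

theorem integrableOn_polarCoord_target {h : ℂ → ℂ} (hh : Integrable h) :
    IntegrableOn (fun p : ℝ × ℝ => p.1 • h (Complex.polarCoord.symm p)) polarCoord.target := by
  have h1 : Integrable (h ∘ measurableEquivRealProd.symm) :=
    (Complex.volume_preserving_equiv_real_prod.symm).integrable_comp_of_integrable hh
  have h2 := (integrableOn_image_iff_integrableOn_abs_det_fderiv_smul volume
    polarCoord.open_target.measurableSet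
    (fun p _ => (hasFDerivAt_polarCoord_symm p).hasFDerivWithinAt)
    polarCoord.symm.injOn (h ∘ measurableEquivRealProd.symm)).1 h1.integrableOn
  refine h2.congr_fun (fun p hp => ?_) polarCoord.open_target.measurableSet
  simp only [det_fderivPolarCoordSymm, Function.comp_apply,
    measurableEquivRealProd_symm_polarCoord_symm_apply]
  rw [abs_of_pos hp.1]

theorem integral_Ioo_circleMap (h : ℂ → ℂ) (r : ℝ) :
    ∫ θ in Ioo (-Real.pi) Real.pi, h (Complex.polarCoord.symm (r, θ)) =
      (2 * Real.pi : ℝ) • circleAverage h 0 r := by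
  rw [Real.circleAverage_eq_integral_add (-Real.pi), smul_smul,
    mul_inv_cancel₀ (by positivity), one_smul,
    intervalIntegral.integral_comp_add_right (fun θ => h (circleMap 0 r θ)),
    ← integral_Ioc_eq_integral_Ioo, intervalIntegral.integral_of_le (by linarith [Real.pi_pos])]
  ring_nf
  refine integral_congr_ae (.of_forall fun θ => ?_)
  simp [circleMap, Complex.exp_mul_I, -polarCoord_symm_apply]

theorem integral_ball_eq_circleAverage {h : ℂ → ℂ} (hh : IntegrableOn h (ball 0 1)) :
    ∫ w in ball (0 : ℂ) 1, h w =
      (2 * Real.pi : ℝ) • ∫ r in Ioo (0 : ℝ) 1, r • circleAverage h 0 r := by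
  have hi := hh.integrable_indicator measurableSet_ball
  rw [← integral_indicator measurableSet_ball, ← Complex.integral_comp_polarCoord_symm]
  have h1 := integrableOn_polarCoord_target hi
  rw [polarCoord_target] at h1 ⊢
  rw [Measure.volume_eq_prod] at h1 ⊢
  rw [setIntegral_prod _ h1, ← integral_smul]
  have hIoo : Ioo (0 : ℝ) 1 = Ioi 0 ∩ Iio 1 := rfl
  rw [hIoo, ← setIntegral_indicator measurableSet_Iio]
  refine setIntegral_congr_fun measurableSet_Ioi fun r (hr : 0 < r) => ?_
  simp only
  rw [integral_smul]
  by_cases hr1 : r < 1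
  · rw [indicator_of_mem (show r ∈ Iio 1 from hr1), smul_comm, ← integral_Ioo_circleMap]
    congr 1
    refine integral_congr_ae (.of_forall fun θ => ?_)
    simp only
    rw [indicator_of_mem]
    rw [mem_ball_zero_iff, norm_polarCoord_symm, abs_of_pos hr]
    exact hr1
  · rw [indicator_of_notMem (show r ∉ Iio 1 from hr1)]
    have : ∀ θ : ℝ, (ball (0 : ℂ) 1).indicator h (Complex.polarCoord.symm (r, θ)) = 0 := fun θ => by
      rw [indicator_of_notMem]
      rw [mem_ball_zero_iff, norm_polarCoord_symm, abs_of_pos hr]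
      exact hr1
    simp only [this, integral_zero, smul_zero]

/-- The radial kernel `(1 - |w|²)₊`. -/
noncomputable def parabolicBump (w : ℂ) : ℝ := max (1 - ‖w‖ ^ 2) 0

theorem circleAverage_div_sub (w : ℂ) {r : ℝ} (hr : 0 < r) (hrw : r ≠ ‖w‖) :
    circleAverage (fun η => η / (w - η)) 0 r = if r < ‖w‖ then 0 else -1 := by
  split_ifs with h
  · have := DiffContOnCl.circleAverage (f := fun η => η / (w - η)) (c := 0) (R := r) (by
      refine DifferentiableOn.diffContOnCl (fun x hx => ?_)
      rw [abs_of_pos hr] at hx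
      have hx' : ‖x‖ ≤ r := by simpa using closure_ball_subset_closedBall hx
      have : w - x ≠ 0 := fun h0 => by rw [sub_eq_zero.1 h0] at h; linarith
      exact DifferentiableAt.differentiableWithinAt (by fun_prop (disch := assumption)))
    simpa using this
  · have := DiffContOnCl.circleAverage_smul_div (f := fun η => (-1 : ℂ)) (c := 0) (R := r) (w := w)
      diffContOnCl_const (by
        rw [abs_of_pos hr, mem_ball_zero_iff]
        exact lt_of_le_of_ne (not_lt.1 h) hrw.symm)
    rw [← this]
    congr 1
    ext η
    rw [sub_zero, smul_eq_mul, ← neg_sub η w, div_neg, mul_neg_one]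

theorem integrableOn_div_sub (w : ℂ) :
    IntegrableOn (fun η => η / (w - η)) (ball 0 1) := by
  refine Integrable.mono' ((integrable_truncKernel (‖w‖ + 1)).comp_sub_left w).integrableOn ?_ ?_
  · exact Measurable.aestronglyMeasurable (by fun_prop)
  · filter_upwards [ae_restrict_mem measurableSet_ball] with η hη
    rw [mem_ball_zero_iff] at hη
    rw [truncKernel_of_le ((norm_sub_le _ _).trans (by linarith)), norm_div, div_eq_mul_inv]
    exact mul_le_of_le_one_left (by positivity) hη.le

theorem integral_ball_div_sub (w : ℂ) :
    ∫ η in ball (0 : ℂ) 1, η / (w - η) = -(Real.pi * parabolicBump w : ℝ) := by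
  rw [integral_ball_eq_circleAverage (integrableOn_div_sub w)]
  have h1 : ∫ r in Ioo (0 : ℝ) 1, r • circleAverage (fun η => η / (w - η)) 0 r =
      ∫ r in Ioo (0 : ℝ) 1, (Ioi ‖w‖).indicator (fun r : ℝ => ((-r : ℝ) : ℂ)) r := by
    refine setIntegral_congr_ae measurableSet_Ioo ?_
    have : ∀ᵐ r : ℝ, r ≠ ‖w‖ := Measure.ae_ne _ _
    filter_upwards [this] with r hr hr0
    rw [circleAverage_div_sub w hr0.1 hr]
    split_ifs with h
    · simp [h.le]
    · rw [indicator_of_mem (show r ∈ Ioi ‖w‖ from lt_of_le_of_ne (not_lt.1 h) hr.symm)]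
      simp
  rw [h1, setIntegral_indicator measurableSet_Ioi, Ioo_inter_Ioi, max_eq_right (norm_nonneg w),
    integral_complex_ofReal]
  have h2 : ∫ r in Ioo ‖w‖ 1, -r = -(parabolicBump w / 2) := by
    rw [integral_neg, neg_inj, parabolicBump]
    rcases le_or_gt ‖w‖ 1 with h | h
    · rw [← integral_Ioc_eq_integral_Ioo, ← intervalIntegral.integral_of_le h, integral_id,
        max_eq_left (by nlinarith [norm_nonneg w])]
      ring
    · rw [Ioo_eq_empty (by linarith), max_eq_right (by nlinarith)]
      simp
  rw [h2]
  push_cast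
  simp only [real_smul]
  push_cast
  ring

theorem integral_ball_mul_eq_zero {f : ℂ → ℂ} {ζ : ℂ} (hf : Continuous f)
    (hd : DifferentiableOn ℂ f (ball ζ 1)) :
    ∫ η in ball (0 : ℂ) 1, f (ζ - η) * η = 0 := by
  rw [integral_ball_eq_circleAverage]
  · rw [setIntegral_eq_zero_of_forall_eq_zero, smul_zero]
    intro r hr
    rw [DiffContOnCl.circleAverage]
    · simp
    · refine DifferentiableOn.diffContOnCl (fun x hx => ?_)
      rw [abs_of_pos hr.1] at hx
      have hx' : ‖x‖ ≤ r := by simpa using closure_ball_subset_closedBall hx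
      have hxb : ζ - x ∈ ball ζ 1 := by
        rw [mem_ball, dist_eq_norm]; simpa using hx'.trans_lt hr.2
      have h1 : DifferentiableAt ℂ f (ζ - x) := (hd _ hxb).differentiableAt (isOpen_ball.mem_nhds hxb)
      refine DifferentiableAt.differentiableWithinAt ?_
      refine DifferentiableAt.mul ?_ differentiableAt_id
      exact DifferentiableAt.comp x h1 (by fun_prop)
  · exact ((by fun_prop : Continuous fun η => f (ζ - η) * η).continuousOn.integrableOn_compact
      (isCompact_closedBall 0 1)).mono_set ball_subset_closedBall


/-- The `∂̄`-derivative, up to a constant, of the convolution of `f` with `parabolicBump`. -/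
noncomputable def smear (f : ℂ → ℂ) (ζ : ℂ) : ℂ := ∫ η in ball (0 : ℂ) 1, f (ζ - η) * η

section smear

variable {f : ℂ → ℂ}

theorem integrable_indicator_id : Integrable ((ball (0 : ℂ) 1).indicator id) :=
  ((continuous_id.continuousOn.integrableOn_compact (isCompact_closedBall 0 1)).mono_set
    ball_subset_closedBall).integrable_indicator measurableSet_ball

theorem smear_eq_integral (f : ℂ → ℂ) (ζ : ℂ) :
    smear f ζ = ∫ η, f (ζ - η) * (ball (0 : ℂ) 1).indicator id η := by
  rw [smear, ← integral_indicator measurableSet_ball]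
  refine integral_congr_ae (.of_forall fun η => ?_)
  by_cases h : η ∈ ball (0 : ℂ) 1 <;> simp [indicator, h]

theorem smear_eq_convolution (f : ℂ → ℂ) :
    smear f = convolution ((ball (0 : ℂ) 1).indicator id) f (ContinuousLinearMap.mul ℝ ℂ) := by
  ext ζ
  rw [smear_eq_integral]
  refine integral_congr_ae (.of_forall fun η => ?_)
  simp [mul_comm]

theorem continuous_smear (hf : Continuous f) (hfs : HasCompactSupport f) :
    Continuous (smear f) := by
  rw [smear_eq_convolution]
  exact hfs.continuous_convolution_right _ integrable_indicator_id.locallyIntegrable hf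

theorem hasCompactSupport_smear (hfs : HasCompactSupport f) : HasCompactSupport (smear f) := by
  rw [smear_eq_convolution]
  refine HasCompactSupport.convolution _ ?_ hfs
  exact HasCompactSupport.intro (isCompact_closedBall (0 : ℂ) 1) fun x hx =>
    indicator_of_notMem (fun h => hx (ball_subset_closedBall h)) _

theorem norm_smear_le {ω : ℝ} (hf : Continuous f) (hω : ∀ x y, ‖x - y‖ ≤ 1 → ‖f x - f y‖ ≤ ω)
    (ζ : ℂ) : ‖smear f ζ‖ ≤ ω * volume.real (ball (0 : ℂ) 1) := by
  have h0 : ∫ η in ball (0 : ℂ) 1, f ζ * η = 0 :=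
    integral_ball_mul_eq_zero (f := fun _ => f ζ) (ζ := 0) continuous_const
      (differentiableOn_const _)
  have hintegrable : ∀ g : ℂ → ℂ, Continuous g → IntegrableOn g (ball 0 1) := fun g hg =>
    (hg.continuousOn.integrableOn_compact (isCompact_closedBall 0 1)).mono_set
      ball_subset_closedBall
  have h1 : smear f ζ = ∫ η in ball (0 : ℂ) 1, (f (ζ - η) - f ζ) * η := by
    simp only [sub_mul]
    rw [integral_sub (hintegrable _ (by fun_prop)) (hintegrable _ (by fun_prop)), h0, sub_zero, smear]
  have hω0 : 0 ≤ ω := (norm_nonneg _).trans (hω 0 0 (by simp))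
  rw [h1]
  refine norm_setIntegral_le_of_norm_le_const measure_ball_lt_top fun η hη => ?_
  rw [mem_ball_zero_iff] at hη
  rw [norm_mul]
  calc _ ≤ ω * 1 := by
        gcongr
        exact hω _ _ (by simpa using hη.le)
    _ = ω := mul_one _

theorem exists_bound (hf : Continuous f) (hfs : HasCompactSupport f) :
    ∃ M S : ℝ, 0 ≤ M ∧ (∀ x, ‖f x‖ ≤ M) ∧ ∀ x, f x ≠ 0 → ‖x‖ ≤ S := by
  obtain ⟨M, hM⟩ := hfs.exists_bound_of_continuous hf
  obtain ⟨S, hS⟩ := hfs.isCompact.isBounded.exists_norm_le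
  exact ⟨M, S, (norm_nonneg _).trans (hM 0), hM, fun x hx => hS x (subset_tsupport f hx)⟩

theorem integrable_indicator_one : Integrable ((ball (0 : ℂ) 1).indicator fun _ => (1 : ℝ)) :=
  (integrable_indicator_iff measurableSet_ball).2 (integrableOn_const measure_ball_lt_top.ne)

theorem integrable_prod_cauchy (hf : Continuous f) (hfs : HasCompactSupport f) (z : ℂ) :
    Integrable (fun p : ℂ × ℂ => f (z - p.1) * (ball (0 : ℂ) 1).indicator id p.2 * (p.1 - p.2)⁻¹)
      (volume.prod volume) := by
  obtain ⟨M, S, hM0, hM, hS⟩ := exists_bound hf hfs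
  have hdom := (Integrable.convolution_integrand (ContinuousLinearMap.mul ℝ ℝ)
    integrable_indicator_one (integrable_truncKernel (S + ‖z‖ + 1))).const_mul M
  refine hdom.mono' ?_ (.of_forall fun p => ?_)
  · have h1 : Measurable ((ball (0 : ℂ) 1).indicator id) :=
      measurable_id.indicator measurableSet_ball
    have h2 := hf.measurable
    exact Measurable.aestronglyMeasurable (by fun_prop)
  · by_cases hf0 : f (z - p.1) = 0
    · simp only [hf0, zero_mul, norm_zero, ContinuousLinearMap.mul_apply']
      have := truncKernel_nonneg (S + ‖z‖ + 1) (p.1 - p.2)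
      have h1 : 0 ≤ (ball (0 : ℂ) 1).indicator (fun _ => (1 : ℝ)) p.2 :=
        indicator_nonneg (fun _ _ => zero_le_one) _
      positivity
    by_cases hp : p.2 ∈ ball (0 : ℂ) 1
    · simp only [indicator_of_mem hp, ContinuousLinearMap.mul_apply', one_mul, id, norm_mul,
        norm_inv]
      have h1 := hS _ hf0
      rw [mem_ball_zero_iff] at hp
      rw [truncKernel_of_le]
      · have := hM (z - p.1)
        gcongr
        exact (mul_le_of_le_one_right (norm_nonneg _) hp.le).trans this
      · have h2 : p.1 - p.2 = z - (z - p.1) - p.2 := by ring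
        rw [h2]
        refine (norm_sub_le _ _).trans ?_
        have := norm_sub_le z (z - p.1)
        linarith
    · simp [indicator_of_notMem hp]

theorem integrable_prod_smear (hf : Continuous f) (hfs : HasCompactSupport f) (z : ℂ) :
    Integrable (fun p : ℂ × ℂ => f (p.1 - p.2) * (ball (0 : ℂ) 1).indicator id p.2 * (z - p.1)⁻¹)
      (volume.prod volume) := by
  obtain ⟨M, S, hM0, hM, hS⟩ := exists_bound hf hfs
  have hdom := (Integrable.mul_prod ((integrable_truncKernel (S + ‖z‖ + 1)).comp_sub_left z)
    integrable_indicator_one).const_mul M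
  refine hdom.mono' ?_ (.of_forall fun p => ?_)
  · have h1 : Measurable ((ball (0 : ℂ) 1).indicator id) :=
      measurable_id.indicator measurableSet_ball
    have h2 := hf.measurable
    exact Measurable.aestronglyMeasurable (by fun_prop)
  · by_cases hf0 : f (p.1 - p.2) = 0
    · simp only [hf0, zero_mul, norm_zero]
      have := truncKernel_nonneg (S + ‖z‖ + 1) (z - p.1)
      have h1 : 0 ≤ (ball (0 : ℂ) 1).indicator (fun _ => (1 : ℝ)) p.2 :=
        indicator_nonneg (fun _ _ => zero_le_one) _
      positivity
    by_cases hp : p.2 ∈ ball (0 : ℂ) 1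
    · simp only [indicator_of_mem hp, mul_one, id, norm_mul, norm_inv]
      have h1 := hS _ hf0
      rw [mem_ball_zero_iff] at hp
      rw [truncKernel_of_le]
      · have := hM (p.1 - p.2)
        gcongr
        exact (mul_le_of_le_one_right (norm_nonneg _) hp.le).trans this
      · have h2 : z - p.1 = z - (p.1 - p.2) - p.2 := by ring
        rw [h2]
        refine (norm_sub_le _ _).trans ?_
        have := norm_sub_le z (p.1 - p.2)
        linarith
    · simp [indicator_of_notMem hp]

theorem integral_parabolicBump_mul (hf : Continuous f) (hfs : HasCompactSupport f) (z : ℂ) :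
    ∫ w, (parabolicBump w : ℂ) * f (z - w) =
      -(Real.pi : ℂ)⁻¹ * ∫ ζ, smear f ζ * (z - ζ)⁻¹ := by
  have hpi : (Real.pi : ℂ) ≠ 0 := by exact_mod_cast Real.pi_ne_zero
  calc ∫ w, (parabolicBump w : ℂ) * f (z - w)
      = ∫ w, -(Real.pi : ℂ)⁻¹ *
          ∫ η, f (z - w) * (ball (0 : ℂ) 1).indicator id η * (w - η)⁻¹ := by
        refine integral_congr_ae (.of_forall fun w => ?_)
        have h1 : ∫ η, f (z - w) * (ball (0 : ℂ) 1).indicator id η * (w - η)⁻¹ =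
            f (z - w) * ∫ η in ball (0 : ℂ) 1, η / (w - η) := by
          rw [← integral_indicator measurableSet_ball, ← integral_const_mul]
          refine integral_congr_ae (.of_forall fun η => ?_)
          by_cases h : η ∈ ball (0 : ℂ) 1 <;> simp [indicator, h, div_eq_mul_inv, mul_assoc]
        simp only
        rw [h1, integral_ball_div_sub]
        push_cast
        field_simp
    _ = -(Real.pi : ℂ)⁻¹ * ∫ η, ∫ w, f (z - w) * (ball (0 : ℂ) 1).indicator id η * (w - η)⁻¹ := by
        rw [integral_const_mul, integral_integral_swap (integrable_prod_cauchy hf hfs z)]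
    _ = -(Real.pi : ℂ)⁻¹ * ∫ η, ∫ ζ, f (ζ - η) * (ball (0 : ℂ) 1).indicator id η * (z - ζ)⁻¹ := by
        congr 1
        refine integral_congr_ae (.of_forall fun η => ?_)
        simp only
        rw [← integral_sub_left_eq_self _ volume (z + η)]
        refine integral_congr_ae (.of_forall fun ζ => ?_)
        simp only
        rw [show z - (z + η - ζ) = ζ - η by ring, show z + η - ζ - η = z - ζ by ring]
    _ = -(Real.pi : ℂ)⁻¹ * ∫ ζ, smear f ζ * (z - ζ)⁻¹ := by
        rw [← integral_integral_swap (integrable_prod_smear hf hfs z)]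
        congr 1
        refine integral_congr_ae (.of_forall fun ζ => ?_)
        simp only
        rw [integral_mul_const, smear_eq_integral]

theorem integrable_smear_mul_inv (hf : Continuous f) (hfs : HasCompactSupport f) (z : ℂ) :
    Integrable fun ζ => smear f ζ * (z - ζ)⁻¹ := by
  refine (integrable_prod_smear hf hfs z).integral_prod_left.congr (.of_forall fun ζ => ?_)
  simp only
  rw [integral_mul_const, smear_eq_integral]

end smear

theorem continuous_parabolicBump : Continuous parabolicBump := by
  unfold parabolicBump; fun_prop

theorem parabolicBump_nonneg (w : ℂ) : 0 ≤ parabolicBump w := le_max_right _ _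

theorem parabolicBump_eq_zero {w : ℂ} (hw : 1 ≤ ‖w‖) : parabolicBump w = 0 :=
  max_eq_right (by nlinarith)

theorem hasCompactSupport_parabolicBump : HasCompactSupport parabolicBump :=
  HasCompactSupport.intro (isCompact_closedBall (0 : ℂ) 1) fun x hx =>
    parabolicBump_eq_zero (by simpa using (not_le.1 (by simpa using hx)).le)

theorem integral_parabolicBump_pos : 0 < ∫ w, parabolicBump w :=
  continuous_parabolicBump.integral_pos_of_hasCompactSupport_nonneg_nonzero
    hasCompactSupport_parabolicBump parabolicBump_nonneg (x := 0) (by simp [parabolicBump])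

theorem norm_integral_parabolicBump_sub_le {f : ℂ → ℂ} {ω : ℝ} (hf : Continuous f)
    (hω : ∀ x y, ‖x - y‖ ≤ 1 → ‖f x - f y‖ ≤ ω) (z : ℂ) :
    ‖(∫ w, parabolicBump w : ℝ) * f z - ∫ w, (parabolicBump w : ℂ) * f (z - w)‖ ≤
      ω * ∫ w, parabolicBump w := by
  have hi : Integrable parabolicBump :=
    continuous_parabolicBump.integrable_of_hasCompactSupport hasCompactSupport_parabolicBump
  have hc : Continuous fun w => (parabolicBump w : ℂ) :=
    continuous_ofReal.comp continuous_parabolicBump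
  have hcs : HasCompactSupport fun w => (parabolicBump w : ℂ) :=
    hasCompactSupport_parabolicBump.comp_left (g := ((↑) : ℝ → ℂ)) ofReal_zero
  have h1 : Integrable fun w => (parabolicBump w : ℂ) * f z :=
    (hc.integrable_of_hasCompactSupport hcs).mul_const _
  have h2 : Integrable fun w => (parabolicBump w : ℂ) * f (z - w) :=
    Continuous.integrable_of_hasCompactSupport (by fun_prop) hcs.mul_right
  rw [← integral_complex_ofReal, ← integral_mul_const, ← integral_sub h1 h2,
    ← integral_const_mul]
  refine norm_integral_le_of_norm_le (hi.const_mul ω) (.of_forall fun w => ?_)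
  rw [← mul_sub, norm_mul, norm_real, Real.norm_of_nonneg (parabolicBump_nonneg w), mul_comm]
  rcases le_or_gt ‖w‖ 1 with h | h
  · have := parabolicBump_nonneg w
    gcongr
    exact hω _ _ (by simpa using h)
  · simp [parabolicBump_eq_zero h.le]

section approximation

variable [CompactSpace K]

theorem exists_kernel_mem_polyClosure (hK : IsCompact K) (hc : IsConnected Kᶜ)
    {a : ℂ} (ha : a ∉ K) : ∃ m : ℂ, ∃ g ∈ polyClosure K, ∀ z : K, ∀ ζ ∈ ball a 2,
      ‖g z + (ζ - m) * g z ^ 2 - ((z : ℂ) - ζ)⁻¹‖ ≤ errorKernel (z - ζ) := by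
  obtain ⟨b, hb1, hb2, s, hs, hsz⟩ := exists_sqrt_mem_polyClosure hK hc ha
  obtain ⟨u, hu, huz⟩ := exists_id_mem_polyClosure (K := K)
  obtain ⟨α, hα, hαz⟩ := exists_const_mem_polyClosure (K := K) a
  obtain ⟨β, hβ, hβz⟩ := exists_const_mem_polyClosure (K := K) ((b - a) / 2)
  refine ⟨a + (b - a) / 2, (8 / (b - a) ^ 2 : ℂ) • (u - α - β - (u - α) * s),
    Subalgebra.smul_mem _ (Subalgebra.sub_mem _ (Subalgebra.sub_mem _ (Subalgebra.sub_mem _ hu hα)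
      hβ) (Subalgebra.mul_mem _ (Subalgebra.sub_mem _ hu hα) hs)) _, fun z ζ hζ => ?_⟩
  rw [mem_ball, dist_eq_norm] at hζ
  have h := norm_slitInv_sub_le (u := z - a) (s := s z) (β := b - a) (ξ := ζ - a) hb1 hb2
    (by rw [(hsz z).1]; ring) (hsz z).2 hζ
  have hg : ((8 / (b - a) ^ 2 : ℂ) • (u - α - β - (u - α) * s)) z =
      slitInv (z - a) (s z) (b - a) := by
    simp only [ContinuousMap.smul_apply, ContinuousMap.sub_apply, ContinuousMap.mul_apply, huz,
      hαz, hβz, smul_eq_mul, slitInv]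
    ring
  rw [hg]
  rw [sub_sub_sub_cancel_right] at h
  rwa [← sub_sub ζ a]

variable {ψ : ℂ → ℂ}

theorem integrable_norm_mul_errorKernel (hψ : Continuous ψ) (hψs : HasCompactSupport ψ) (z : ℂ) :
    Integrable fun ζ => ‖ψ ζ‖ * errorKernel (z - ζ) := by
  obtain ⟨M, hM⟩ := hψs.exists_bound_of_continuous hψ
  exact (integrable_errorKernel.comp_sub_left z).bdd_mul hψ.norm.aestronglyMeasurable
    (.of_forall fun ζ => by simpa using hM ζ)

theorem exists_approx_setIntegral_ball (hK : IsCompact K) (hc : IsConnected Kᶜ)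
    (hψ : Continuous ψ) (hψs : HasCompactSupport ψ)
    (hψi : ∀ z, Integrable fun ζ => ψ ζ * (z - ζ)⁻¹) {a : ℂ} (ha : a ∉ K) {T : Set ℂ}
    (hT : MeasurableSet T) (hTa : T ⊆ ball a 2) :
    ∃ F ∈ polyClosure K, ∀ z : K, ‖F z - ∫ ζ in T, ψ ζ * ((z : ℂ) - ζ)⁻¹‖ ≤
      ∫ ζ in T, ‖ψ ζ‖ * errorKernel (z - ζ) := by
  obtain ⟨m, g, hg, h⟩ := exists_kernel_mem_polyClosure hK hc ha
  refine ⟨(∫ ζ in T, ψ ζ) • g + (∫ ζ in T, ψ ζ * (ζ - m)) • g ^ 2,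
    Subalgebra.add_mem _ (Subalgebra.smul_mem _ hg _)
      (Subalgebra.smul_mem _ (Subalgebra.pow_mem _ hg 2) _), fun z => ?_⟩
  have h1 : IntegrableOn ψ T := (hψ.integrable_of_hasCompactSupport hψs).integrableOn
  have h2 : IntegrableOn (fun ζ => ψ ζ * (ζ - m)) T :=
    (Continuous.integrable_of_hasCompactSupport (by fun_prop) hψs.mul_right).integrableOn
  have h12 : IntegrableOn (fun ζ => ψ ζ * g z + ψ ζ * (ζ - m) * g z ^ 2) T :=
    (h1.mul_const _).add (h2.mul_const _)
  simp only [ContinuousMap.add_apply, ContinuousMap.smul_apply, ContinuousMap.pow_apply,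
    smul_eq_mul]
  rw [← integral_mul_const, ← integral_mul_const,
    ← integral_add (h1.mul_const _) (h2.mul_const _),
    ← integral_sub h12 (hψi z).integrableOn]
  refine norm_integral_le_of_norm_le (integrable_norm_mul_errorKernel hψ hψs z).integrableOn ?_
  filter_upwards [ae_restrict_mem hT] with ζ hζ
  have h3 : ψ ζ * g z + ψ ζ * (ζ - m) * g z ^ 2 - ψ ζ * ((z : ℂ) - ζ)⁻¹ =
      ψ ζ * (g z + (ζ - m) * g z ^ 2 - ((z : ℂ) - ζ)⁻¹) := by ring
  rw [h3, norm_mul]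
  gcongr
  exact h z ζ (hTa hζ)

theorem exists_approx_integral (hK : IsCompact K) (hc : IsConnected Kᶜ)
    (hψ : Continuous ψ) (hψs : HasCompactSupport ψ)
    (hψi : ∀ z, Integrable fun ζ => ψ ζ * (z - ζ)⁻¹)
    (hnear : ∀ ζ, ψ ζ ≠ 0 → ∃ a ∉ K, ‖ζ - a‖ < 1) :
    ∃ F ∈ polyClosure K, ∀ z : K, ‖F z - ∫ ζ, ψ ζ * ((z : ℂ) - ζ)⁻¹‖ ≤
      ∫ ζ, ‖ψ ζ‖ * errorKernel (z - ζ) := by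
  have hcover : ∃ S ⊇ tsupport ψ, MeasurableSet S ∧ ∀ T ⊆ S, MeasurableSet T →
      ∃ F ∈ polyClosure K, ∀ z : K, ‖F z - ∫ ζ in T, ψ ζ * ((z : ℂ) - ζ)⁻¹‖ ≤
        ∫ ζ in T, ‖ψ ζ‖ * errorKernel (z - ζ) := by
    refine hψs.isCompact.induction_on (p := fun N => ∃ S ⊇ N, MeasurableSet S ∧ ∀ T ⊆ S,
      MeasurableSet T → ∃ F ∈ polyClosure K, ∀ z : K,
        ‖F z - ∫ ζ in T, ψ ζ * ((z : ℂ) - ζ)⁻¹‖ ≤ ∫ ζ in T, ‖ψ ζ‖ * errorKernel (z - ζ))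
      ?_ ?_ ?_ ?_
    · refine ⟨∅, Subset.rfl, MeasurableSet.empty, fun T hT _ => ⟨0, Subalgebra.zero_mem _, ?_⟩⟩
      simp [subset_empty_iff.1 hT]
    · rintro N N' hN ⟨S, hS, h⟩
      exact ⟨S, hN.trans hS, h⟩
    · rintro N N' ⟨S, hS, hSm, h⟩ ⟨S', hS', hSm', h'⟩
      refine ⟨S ∪ S', union_subset_union hS hS', hSm.union hSm', fun T hT hTm => ?_⟩
      obtain ⟨F, hF, hFz⟩ := h (T ∩ S) inter_subset_right (hTm.inter hSm)
      obtain ⟨F', hF', hFz'⟩ := h' (T \ S) (fun x hx => (hT hx.1).resolve_left hx.2)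
        (hTm.diff hSm)
      refine ⟨F + F', Subalgebra.add_mem _ hF hF', fun z => ?_⟩
      rw [← integral_inter_add_sdiff hSm (hψi z).integrableOn,
        ← integral_inter_add_sdiff hSm (integrable_norm_mul_errorKernel hψ hψs z).integrableOn,
        ContinuousMap.add_apply, add_sub_add_comm]
      exact (norm_add_le _ _).trans (add_le_add (hFz z) (hFz' z))
    · intro ζ hζ
      obtain ⟨η, hη, hd⟩ := Metric.mem_closure_iff.1 hζ 1 one_pos
      obtain ⟨a, ha, hda⟩ := hnear η hη
      refine ⟨ball a 2, mem_nhdsWithin_of_mem_nhds (isOpen_ball.mem_nhds ?_), ball a 2, Subset.rfl,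
        measurableSet_ball, fun T hT hTm =>
          exists_approx_setIntegral_ball hK hc hψ hψs hψi ha hTm hT⟩
      rw [mem_ball]
      rw [← dist_eq_norm] at hda
      linarith [dist_triangle ζ η a]
  obtain ⟨S, hS, hSm, h⟩ := hcover
  obtain ⟨F, hF, hFz⟩ := h S Subset.rfl hSm
  have h0 : ∀ ζ ∉ S, ψ ζ = 0 := fun ζ hζ => image_eq_zero_of_notMem_tsupport fun h => hζ (hS h)
  refine ⟨F, hF, fun z => ?_⟩
  have := hFz z
  rwa [setIntegral_eq_integral_of_forall_compl_eq_zero fun ζ hζ => by simp [h0 ζ hζ],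
    setIntegral_eq_integral_of_forall_compl_eq_zero fun ζ hζ => by simp [h0 ζ hζ]] at this

/-- The constant in the estimate at unit scale. -/
noncomputable def approxConst : ℝ :=
  1 + (Real.pi * ∫ w, parabolicBump w)⁻¹ * (volume.real (ball (0 : ℂ) 1) * ∫ w, errorKernel w)

theorem one_le_approxConst : 1 ≤ approxConst := by
  have h1 := integral_parabolicBump_pos
  have h2 : 0 ≤ ∫ w, errorKernel w := integral_nonneg errorKernel_nonneg
  have := Real.pi_pos
  rw [approxConst, le_add_iff_nonneg_right]
  positivity

theorem exists_approx_of_oscillation (hK : IsCompact K) (hc : IsConnected Kᶜ) {f : ℂ → ℂ}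
    (hf : Continuous f) (hfs : HasCompactSupport f) (hd : DifferentiableOn ℂ f (interior K))
    {ω : ℝ} (hω : ∀ x y, ‖x - y‖ ≤ 1 → ‖f x - f y‖ ≤ ω) :
    ∃ F ∈ polyClosure K, ∀ z : K, ‖f z - F z‖ ≤ approxConst * ω := by
  have hnear : ∀ ζ, smear f ζ ≠ 0 → ∃ a ∉ K, ‖ζ - a‖ < 1 := by
    intro ζ hζ
    by_contra! h
    refine hζ (integral_ball_mul_eq_zero hf (hd.mono (interior_maximal (fun x hx => ?_)
      isOpen_ball)))
    by_contra hxK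
    rw [mem_ball, dist_comm, dist_eq_norm] at hx
    exact (h x hxK).not_gt hx
  obtain ⟨F, hF, hFz⟩ := exists_approx_integral hK hc (continuous_smear hf hfs)
    (hasCompactSupport_smear hfs) (integrable_smear_mul_inv hf hfs) hnear
  set J := ∫ w, parabolicBump w with hJ
  have hJ0 : 0 < J := integral_parabolicBump_pos
  have hpi := Real.pi_pos
  have hpi' : (Real.pi : ℂ) ≠ 0 := by exact_mod_cast hpi.ne'
  have hJ' : (J : ℂ) ≠ 0 := by exact_mod_cast hJ0.ne'
  refine ⟨(-((Real.pi * J : ℝ) : ℂ)⁻¹) • F, Subalgebra.smul_mem _ hF _, fun z => ?_⟩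
  set V := volume.real (ball (0 : ℂ) 1) with hV
  have h1 := norm_integral_parabolicBump_sub_le hf hω z
  rw [← hJ, integral_parabolicBump_mul hf hfs] at h1
  have h2 : ‖F z - ∫ ζ, smear f ζ * ((z : ℂ) - ζ)⁻¹‖ ≤ ω * V * ∫ w, errorKernel w := by
    refine (hFz z).trans ?_
    rw [← integral_sub_left_eq_self errorKernel volume (z : ℂ), ← integral_const_mul]
    refine integral_mono (integrable_norm_mul_errorKernel (continuous_smear hf hfs)
      (hasCompactSupport_smear hfs) z) ((integrable_errorKernel.comp_sub_left _).const_mul _)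
      fun ζ => ?_
    exact mul_le_mul_of_nonneg_right (norm_smear_le hf hω ζ) (errorKernel_nonneg _)
  set I := ∫ ζ, smear f ζ * ((z : ℂ) - ζ)⁻¹
  have h3 : f z - ((-((Real.pi * J : ℝ) : ℂ)⁻¹) • F) z =
      (J : ℂ)⁻¹ * (J * f z - -(Real.pi : ℂ)⁻¹ * I) + ((Real.pi * J : ℝ) : ℂ)⁻¹ * (F z - I) := by
    rw [ContinuousMap.smul_apply, smul_eq_mul]
    push_cast
    field_simp
    ring
  rw [h3]
  calc _ ≤ ‖(J : ℂ)⁻¹ * (J * f z - -(Real.pi : ℂ)⁻¹ * I)‖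
        + ‖((Real.pi * J : ℝ) : ℂ)⁻¹ * (F z - I)‖ := norm_add_le _ _
    _ ≤ J⁻¹ * (ω * J) + (Real.pi * J)⁻¹ * (ω * V * ∫ w, errorKernel w) := by
      rw [norm_mul, norm_mul, norm_inv, norm_inv, norm_real, norm_real,
        Real.norm_of_nonneg hJ0.le, Real.norm_of_nonneg (by positivity)]
      gcongr
    _ = approxConst * ω := by
      rw [approxConst, ← hJ, ← hV]
      field_simp

end approximation

theorem exists_polynomial_approx_of_mem_polyClosure [CompactSpace K] {F : C(K, ℂ)}
    (hF : F ∈ polyClosure K) {ε : ℝ} (hε : 0 < ε) :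
    ∃ p : Polynomial ℂ, ∀ z : K, ‖F z - p.eval (z : ℂ)‖ < ε := by
  have hF' : F ∈ closure (polynomialFunctions K : Set C(K, ℂ)) := hF
  obtain ⟨q, hq, hFq⟩ := Metric.mem_closure_iff.1 hF' ε hε
  obtain ⟨p, -, rfl⟩ := hq
  refine ⟨p, fun z => ?_⟩
  rw [← dist_eq_norm]
  exact (ContinuousMap.dist_apply_le_dist z).trans_lt hFq

/-- **Mergelyan's theorem** for compactly supported continuous functions on the plane. -/
theorem exists_polynomial_approx (hK : IsCompact K) (hc : IsConnected Kᶜ) {f : ℂ → ℂ}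
    (hf : Continuous f) (hfs : HasCompactSupport f) (hd : DifferentiableOn ℂ f (interior K))
    {ε : ℝ} (hε : 0 < ε) : ∃ p : Polynomial ℂ, ∀ z ∈ K, ‖f z - p.eval z‖ < ε := by
  have hC : 0 < approxConst := one_pos.trans_le one_le_approxConst
  obtain ⟨δ, hδ, hδf⟩ := Metric.uniformContinuous_iff.1
    (hfs.uniformContinuous_of_continuous hf) (ε / (2 * approxConst)) (by positivity)
  have hr0 : ((δ / 2 : ℝ) : ℂ) ≠ 0 := by exact_mod_cast (half_pos hδ).ne'
  set e : ℂ ≃ₜ ℂ := Homeomorph.mulLeft₀ ((δ / 2 : ℝ) : ℂ) hr0 with he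
  have he' : ∀ z, e z = ((δ / 2 : ℝ) : ℂ) * z := fun z => rfl
  have hL : IsCompact (e ⁻¹' K) := e.isCompact_preimage.2 hK
  have : CompactSpace (e ⁻¹' K) := isCompact_iff_compactSpace.1 hL
  obtain ⟨F, hF, hFz⟩ := exists_approx_of_oscillation (K := e ⁻¹' K) (f := f ∘ e)
    (ω := ε / (2 * approxConst)) hL
    (by rw [← preimage_compl]; exact e.isConnected_preimage.2 hc)
    (hf.comp e.continuous) (hfs.comp_homeomorph e)
    (by
      rw [← e.preimage_interior]
      exact hd.comp (fun z _ => by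
        have : DifferentiableAt ℂ (fun z => ((δ / 2 : ℝ) : ℂ) * z) z := by fun_prop
        exact this.differentiableWithinAt) fun z hz => hz)
    (fun x y hxy => by
      rw [← dist_eq_norm]
      refine (hδf ?_).le
      rw [he', he', dist_eq_norm, ← mul_sub, norm_mul, norm_real,
        Real.norm_of_nonneg (by positivity)]
      nlinarith)
  obtain ⟨p, hp⟩ := exists_polynomial_approx_of_mem_polyClosure hF (half_pos hε)
  refine ⟨p.comp (Polynomial.C ((δ / 2 : ℝ) : ℂ)⁻¹ * Polynomial.X), fun z hz => ?_⟩
  have hz' : ((δ / 2 : ℝ) : ℂ) * (((δ / 2 : ℝ) : ℂ)⁻¹ * z) = z := mul_inv_cancel_left₀ hr0 z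
  have hmem : ((δ / 2 : ℝ) : ℂ)⁻¹ * z ∈ e ⁻¹' K := by
    rw [mem_preimage, he', hz']; exact hz
  have h1 := hFz ⟨_, hmem⟩
  have h2 := hp ⟨_, hmem⟩
  rw [Function.comp_apply, he', hz', mul_div_assoc', mul_comm 2 approxConst,
    mul_div_mul_left _ _ hC.ne'] at h1
  rw [Polynomial.eval_comp, Polynomial.eval_mul, Polynomial.eval_C, Polynomial.eval_X]
  calc _ ≤ _ := norm_sub_le_norm_sub_add_norm_sub _ (F ⟨_, hmem⟩) _
    _ < ε := by linarith

theorem exists_compactlySupported_extension (hK : IsCompact K) {f : ℂ → ℂ}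
    (hf : ContinuousOn f K) :
    ∃ g : ℂ → ℂ, Continuous g ∧ HasCompactSupport g ∧ EqOn g f K := by
  obtain ⟨g, hg⟩ := ContinuousMap.exists_restrict_eq hK.isClosed ⟨K.domRestrict f, hf.domRestrict⟩
  obtain ⟨χ, hχ1, -, hχs, -⟩ :=
    exists_continuous_one_zero_of_isCompact hK isClosed_empty (disjoint_empty K)
  refine ⟨fun z => (χ z : ℂ) * g z, by fun_prop, ?_, fun z hz => ?_⟩
  · exact (hχs.comp_left (g := ((↑) : ℝ → ℂ)) ofReal_zero).mul_right
  · have h1 : g z = f z := DFunLike.congr_fun hg ⟨z, hz⟩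
    simp [hχ1 hz, h1]

theorem eval_map_conj (p : Polynomial ℂ) (z : ℂ) :
    (p.map (starRingEnd ℂ)).eval z = starRingEnd ℂ (p.eval (starRingEnd ℂ z)) := by
  rw [← Polynomial.eval_map_apply, Complex.conj_conj]

end Mergelyan

/-- If `K ⊆ ℂ` is a real-symmetric compact set with connected complement, then every
real-symmetric function continuous on `K` and holomorphic on the interior of `K` can be
uniformly approximated on `K` by real-symmetric algebraic polynomials. -/
theorem symmetric_poly_approx (K : Set ℂ) (hK : IsCompact K)
    (hsym : (starRingEnd ℂ) '' K = K) (hc : IsConnected Kᶜ)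
    (f : ℂ → ℂ) (hfc : ContinuousOn f K) (hfd : DifferentiableOn ℂ f (interior K))
    (hfsym : ∀ z ∈ K, f z = starRingEnd ℂ (f (starRingEnd ℂ z))) :
    ∀ ε > 0, ∃ p : Polynomial ℂ,
      (∀ z : ℂ, p.eval (starRingEnd ℂ z) = starRingEnd ℂ (p.eval z)) ∧
      ∀ z ∈ K, ‖f z - p.eval z‖ < ε := by
  intro ε hε
  obtain ⟨g, hg, hgs, hgf⟩ := Mergelyan.exists_compactlySupported_extension hK hfc
  obtain ⟨p, hp⟩ := Mergelyan.exists_polynomial_approx hK hc hg hgs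
    (hfd.congr fun z hz => hgf (interior_subset hz)) hε
  have hp' : ∀ z ∈ K, ‖f z - p.eval z‖ < ε := fun z hz => hgf hz ▸ hp z hz
  have heval : ∀ z, (Polynomial.C (2⁻¹ : ℂ) * (p + p.map (starRingEnd ℂ))).eval z =
      2⁻¹ * (p.eval z + starRingEnd ℂ (p.eval (starRingEnd ℂ z))) := fun z => by
    rw [Polynomial.eval_mul, Polynomial.eval_C, Polynomial.eval_add, Mergelyan.eval_map_conj]
  refine ⟨Polynomial.C (2⁻¹ : ℂ) * (p + p.map (starRingEnd ℂ)), fun z => ?_, fun z hz => ?_⟩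
  · rw [heval, heval]
    simp only [map_mul, map_add, map_inv₀, map_ofNat, Complex.conj_conj, add_comm]
  · have hz' : starRingEnd ℂ z ∈ K := hsym ▸ mem_image_of_mem _ hz
    have h1 := hp' z hz
    have h2 := hp' _ hz'
    rw [← Complex.norm_conj, map_sub, ← hfsym z hz] at h2
    have h3 : f z - 2⁻¹ * (p.eval z + starRingEnd ℂ (p.eval (starRingEnd ℂ z))) =
        2⁻¹ * (f z - p.eval z) + 2⁻¹ * (f z - starRingEnd ℂ (p.eval (starRingEnd ℂ z))) := by
      ring
    rw [heval, h3]
    refine (norm_add_le _ _).trans_lt ?_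
    rw [norm_mul, norm_mul, norm_inv, Complex.norm_ofNat]
    linarith
end

section
/- Let K be a real-symmetric compact subset of ℂ with ℂ \ K connected, and let f be a real-symmetric function continuous on K and holomorphic on the interior of K. Then for every ε > 0 there exists a real-symmetric Dirichlet polynomial D such that |f(z) − D(z)| < ε for all z ∈ K. -/
open Complex Set

/-- A Dirichlet polynomial: a function of the form `z ↦ ∑_{k=1}^m a_k k^{-z}`. -/
def IsDirichletPolynomial (f : ℂ → ℂ) : Prop :=
  ∃ (m : ℕ) (a : ℕ → ℂ), ∀ z : ℂ, f z = ∑ k ∈ Finset.Icc 1 m, a k * (k : ℂ) ^ (-z)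

open scoped Topology NNReal

section Algebra

variable {K : Set ℂ} [CompactSpace K] (S : Subalgebra ℂ C(K, ℂ))

/-- The coordinate function on a subset of the plane. -/
def coordinate (K : Set ℂ) : C(K, ℂ) := ⟨Subtype.val, continuous_subtype_val⟩

theorem exists_mem_eq_inv_sub (hS : IsClosed (S : Set C(K, ℂ))) (hX : coordinate K ∈ S)
    (hK : IsPreconnected Kᶜ) {q : ℂ} (hq : q ∉ K) :
    ∃ φ ∈ S, ∀ z : K, φ z = (z - q)⁻¹ := by
  have hrange : spectrum ℂ (coordinate K) = K := by
    rw [ContinuousMap.spectrum_eq_range]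
    exact Subtype.range_coe
  have := hS
  have hspec := Subalgebra.spectrum_eq_of_isPreconnected_compl (𝕜 := ℂ) S ⟨coordinate K, hX⟩
    (by simpa [hrange] using hK)
  have hq' : q ∉ spectrum ℂ (⟨coordinate K, hX⟩ : S) := by
    rw [hspec]
    simpa [hrange] using hq
  rw [spectrum.notMem_iff] at hq'
  obtain ⟨y, hy⟩ := hq'.exists_right_inv
  refine ⟨-y, neg_mem y.2, fun z ↦ ?_⟩
  have h := congrArg (fun φ : S ↦ (φ : C(K, ℂ)) z) hy
  have h' : (q - z) * (y : C(K, ℂ)) z = 1 := h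
  refine eq_inv_of_mul_eq_one_left ?_
  rw [ContinuousMap.neg_apply]
  linear_combination h'

theorem exists_mem_eq_comp (hS : IsClosed (S : Set C(K, ℂ))) {F : ℂ → ℂ}
    (hF : DifferentiableOn ℂ F (Metric.ball 0 1)) {x : C(K, ℂ)} (hx : x ∈ S) (hx1 : ‖x‖ < 1) :
    ∃ φ ∈ S, ∀ z : K, φ z = F (x z) := by
  obtain ⟨r, hxr, hr1⟩ := exists_between hx1
  obtain ⟨R, hrR, hR1⟩ := exists_between hr1
  have hr0 : 0 < r := (norm_nonneg x).trans_lt hxr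
  lift r to ℝ≥0 using hr0.le
  lift R to ℝ≥0 using (hr0.trans hrR).le
  have hps := (hF.mono (Metric.closedBall_subset_ball hR1)).hasFPowerSeriesOnBall
    (by exact_mod_cast hr0.trans hrR)
  have hmaps : ∀ z : K, x z ∈ Metric.ball (0 : ℂ) r := fun z ↦ by
    simpa using (x.norm_coe_le_norm z).trans_lt hxr
  have hcont : Continuous fun z : K ↦ F (x z) :=
    hF.continuousOn.comp_continuous x.continuous fun z ↦
      Metric.ball_subset_ball (by exact_mod_cast hr1.le) (hmaps z)
  have hunif := hps.tendstoUniformlyOn (r' := r) (by exact_mod_cast hrR)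
  set p := cauchyPowerSeries F 0 R
  let s : ℕ → C(K, ℂ) := fun n ↦ ∑ k ∈ Finset.range n, p.coeff k • x ^ k
  have hs : ∀ n, s n ∈ S := fun n ↦ sum_mem fun k _ ↦ S.smul_mem (pow_mem hx k) _
  refine ⟨⟨_, hcont⟩, hS.mem_of_tendsto (b := Filter.atTop) (f := s) ?_ (.of_forall hs),
    fun z ↦ rfl⟩
  rw [ContinuousMap.tendsto_iff_tendstoUniformly, Metric.tendstoUniformly_iff]
  intro ε hε
  filter_upwards [Metric.tendstoUniformlyOn_iff.1 hunif ε hε] with n hn z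
  simpa [s, FormalMultilinearSeries.partialSum, mul_comm] using hn (x z) (hmaps z)

theorem exists_mem_sq_eq (hS : IsClosed (S : Set C(K, ℂ))) {x : C(K, ℂ)} (hx : x ∈ S)
    (hx1 : ‖x‖ < 1) :
    ∃ φ ∈ S, ∀ z : K, φ z ^ 2 = 1 - x z ∧ 0 < (φ z).re := by
  have hslit : ∀ w ∈ Metric.ball (0 : ℂ) 1, 0 < (1 - w).re := fun w hw ↦ by
    have := (re_le_norm w).trans_lt (mem_ball_zero_iff.1 hw)
    simpa using this
  obtain ⟨φ, hφ, h⟩ := exists_mem_eq_comp S hS (F := fun w ↦ exp (log (1 - w) / 2))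
    (fun w hw ↦ by
      have : 1 - w ∈ slitPlane := .inl (hslit w hw)
      refine DifferentiableAt.differentiableWithinAt ?_
      exact (((differentiableAt_id.const_sub 1).clog this).div_const 2).cexp) hx hx1
  refine ⟨φ, hφ, fun z ↦ ?_⟩
  have hz : x z ∈ Metric.ball (0 : ℂ) 1 := by
    simpa using (x.norm_coe_le_norm z).trans_lt hx1
  have hre := hslit _ hz
  have hne : 1 - x z ≠ 0 := fun h0 ↦ by simp [h0] at hre
  constructor
  · rw [h, ← exp_nat_mul]
    push_cast
    rw [mul_div_cancel₀ _ two_ne_zero, exp_log hne]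
  · rw [h, exp_re]
    refine mul_pos (Real.exp_pos _) (Real.cos_pos_of_mem_Ioo ?_)
    have him : (log (1 - x z) / 2).im = arg (1 - x z) / 2 := by simp [log_im]
    rw [him]
    constructor <;> linarith [neg_pi_lt_arg (1 - x z), arg_le_pi (1 - x z), Real.pi_pos,
      (abs_lt.1 (abs_arg_lt_pi_div_two_iff.2 (.inl hre))).1,
      (abs_lt.1 (abs_arg_lt_pi_div_two_iff.2 (.inl hre))).2]

end Algebra

section Kernel

theorem re_div_sub_pos {z a b : ℂ} (h : ‖b - a‖ < ‖z - b‖) : 0 < ((z - a) / (z - b)).re := by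
  have hz : z - b ≠ 0 := norm_pos_iff.1 ((norm_nonneg _).trans_lt h)
  have h1 : (z - a) / (z - b) = 1 + (b - a) / (z - b) := by
    rw [eq_comm, one_add_div hz]; ring_nf
  have h2 : ‖(b - a) / (z - b)‖ < 1 := by
    rw [norm_div, div_lt_one (norm_pos_iff.2 hz)]
    exact h
  have h3 := neg_le_of_abs_le (abs_re_le_norm ((b - a) / (z - b)))
  rw [h1, add_re, one_re]
  linarith

theorem abs_im_lt_re_of_sq_re_pos {h : ℂ} (h2 : 0 < (h ^ 2).re) (h0 : 0 < h.re) :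
    |h.im| < h.re := by
  rw [pow_two, mul_re] at h2
  exact abs_lt_of_sq_lt_sq (by nlinarith) h0.le

theorem re_mul_pos_of_abs_im_lt_re {h k : ℂ} (hh : |h.im| < h.re) (hk : |k.im| < k.re) :
    0 < (h * k).re := by
  have h1 : |h.im * k.im| < h.re * k.re := by
    rw [abs_mul]
    exact mul_lt_mul'' hh hk (abs_nonneg _) (abs_nonneg _)
  rw [mul_re]
  linarith [(abs_lt.1 h1).2]

variable {K : Set ℂ} [CompactSpace K] (S : Subalgebra ℂ C(K, ℂ))

/-- The points `b` of `ball x r` outside `K` for which the algebra `S` contains a square root of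
`(z - a) / (z - b)` that is the principal one away from `x`. -/
def sqrtReachable (x : ℂ) (r : ℝ) (a : ℂ) : Set ℂ :=
  {b | b ∉ K ∧ b ∈ Metric.ball x r ∧ ∃ H ∈ S, ∀ z : K, H z ^ 2 = (z - a) / (z - b) ∧
    (4 * r ≤ ‖z - x‖ → 0 < (H z).re)}

variable {S}

theorem mem_sqrtReachable_of_near (hS : IsClosed (S : Set C(K, ℂ))) (hX : coordinate K ∈ S)
    (hK : IsPreconnected Kᶜ) {x a b b' : ℂ} {r t : ℝ} (ha : a ∈ Metric.ball x r)
    (hb : b ∈ sqrtReachable S x r a) (hb' : b' ∈ Metric.ball x r)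
    (hball : Metric.ball b' t ⊆ Kᶜ) (hbb : ‖b - b'‖ < t) : b' ∈ sqrtReachable S x r a := by
  obtain ⟨hbK, hbx, H, hHS, hH⟩ := hb
  have ht : 0 < t := (norm_nonneg _).trans_lt hbb
  have hb'K : b' ∉ K := hball (Metric.mem_ball_self ht)
  obtain ⟨φ, hφS, hφ⟩ := exists_mem_eq_inv_sub S hS hX hK hb'K
  have hdist : ∀ z : K, t ≤ ‖(z : ℂ) - b'‖ := fun z ↦ by
    by_contra! h
    exact hball (mem_ball_iff_norm.2 h) z.2
  have hnorm : ‖(b - b') • φ‖ < 1 := by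
    refine (ContinuousMap.norm_le _ (div_nonneg (norm_nonneg (b - b')) ht.le)).2
      (fun z ↦ ?_) |>.trans_lt ((div_lt_one ht).2 hbb)
    rw [ContinuousMap.smul_apply, hφ, smul_eq_mul, ← div_eq_mul_inv, norm_div]
    gcongr
    exact hdist z
  obtain ⟨T, hTS, hT⟩ := exists_mem_sq_eq S hS (S.smul_mem hφS (b - b')) hnorm
  have hTsq : ∀ z : K, T z ^ 2 = (z - b) / (z - b') := fun z ↦ by
    have hz : (z : ℂ) - b' ≠ 0 := norm_pos_iff.1 (ht.trans_le (hdist z))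
    rw [(hT z).1, ContinuousMap.smul_apply, hφ, smul_eq_mul]
    field_simp
    ring
  refine ⟨hb'K, hb', H * T, mul_mem hHS hTS, fun z ↦ ⟨?_, fun hz ↦ ?_⟩⟩
  · have hz : (z : ℂ) - b ≠ 0 := sub_ne_zero.2 fun h ↦ hbK (h ▸ z.2)
    rw [ContinuousMap.mul_apply, mul_pow, (hH z).1, hTsq]
    field_simp
  · rw [Metric.mem_ball, dist_eq_norm] at ha hbx hb'
    have hpos : ∀ {p q : ℂ}, ‖p - x‖ < r → ‖q - x‖ < r → 0 < ((z - p) / (z - q)).re :=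
      fun {p q} hp hq ↦ re_div_sub_pos <| by
        have h1 := norm_sub_le (q - x) (p - x)
        have h2 := norm_sub_norm_le (z - x : ℂ) (q - x)
        rw [sub_sub_sub_cancel_right] at h1 h2
        linarith [norm_nonneg (p - x)]
    refine re_mul_pos_of_abs_im_lt_re (abs_im_lt_re_of_sq_re_pos ?_ ((hH z).2 hz))
      (abs_im_lt_re_of_sq_re_pos ?_ (hT z).2)
    · rw [(hH z).1]; exact hpos ha hbx
    · rw [hTsq]; exact hpos hbx hb'

theorem exists_mem_sqrtReachable (hS : IsClosed (S : Set C(K, ℂ))) (hX : coordinate K ∈ S)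
    (hK : IsPreconnected Kᶜ) {x a : ℂ} {r R : ℝ} (ha : a ∈ Metric.ball x r) (haK : a ∉ K)
    (hR : R < r) : ∃ b ∈ sqrtReachable S x r a, R ≤ ‖b - x‖ := by
  by_contra! hfar
  have hKc : IsCompact K := isCompact_iff_compactSpace.2 ‹_›
  have hKo : IsOpen Kᶜ := hKc.isClosed.isOpen_compl
  have hopen : IsOpen (sqrtReachable S x r a) := by
    rw [Metric.isOpen_iff]
    intro b hb
    obtain ⟨t, ht, hsub⟩ := Metric.isOpen_iff.1 (hKo.inter Metric.isOpen_ball) b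
      (⟨hb.1, hb.2.1⟩ : b ∈ Kᶜ ∩ Metric.ball x r)
    refine ⟨t / 2, half_pos ht, fun b' hb' ↦ ?_⟩
    rw [mem_ball_iff_norm] at hb'
    have hb'' : b' ∈ Metric.ball b t := mem_ball_iff_norm.2 (by linarith)
    refine mem_sqrtReachable_of_near hS hX hK (t := t / 2) ha hb (hsub hb'').2
      (fun y hy ↦ (hsub ?_).1) (by rwa [norm_sub_rev])
    rw [mem_ball_iff_norm] at hy ⊢
    have := norm_add_le (y - b') (b' - b)
    rw [sub_add_sub_cancel] at this
    linarith
  have hself : a ∈ sqrtReachable S x r a := by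
    refine ⟨haK, ha, 1, one_mem S, fun z ↦ ⟨?_, fun _ ↦ by simp⟩⟩
    rw [div_self (sub_ne_zero.2 fun h : (z : ℂ) = a ↦ haK (h ▸ z.2))]
    simp
  have hclosed : closure (sqrtReachable S x r a) ∩ Kᶜ ⊆ sqrtReachable S x r a := by
    rintro b ⟨hb, hbK⟩
    have hbR : b ∈ Metric.closedBall x R :=
      closure_minimal (fun c hc ↦ mem_closedBall_iff_norm.2 (hfar c hc).le)
        Metric.isClosed_closedBall hb
    obtain ⟨t, ht, hsub⟩ := Metric.isOpen_iff.1 hKo b hbK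
    obtain ⟨c, hc, hcb⟩ := Metric.mem_closure_iff.1 hb t ht
    exact mem_sqrtReachable_of_near hS hX hK ha hc (Metric.closedBall_subset_ball hR hbR) hsub
      (by rwa [← dist_eq_norm, dist_comm])
  have hsub := hK.subset_of_closure_inter_subset hopen ⟨a, haK, hself⟩ hclosed
  refine NormedSpace.unbounded_univ ℂ ℂ ?_
  rw [← union_compl_self K]
  exact hKc.isBounded.union
    ((Metric.isBounded_ball (x := x) (r := r)).subset fun y hy ↦ (hsub hy).2.1)

/-- A quadratic polynomial in a root `g` of `d² g² / 4 - w g + 1 = 0` approximates the Cauchy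
kernel, the root being of order `1 / w`. -/
theorem norm_quadratic_sub_inv_le_of_far {δ : ℝ} (hδ : 0 < δ) {g w d η : ℂ} (hd : ‖d‖ ≤ 4 * δ)
    (hη : ‖η‖ ≤ 5 * δ) (hw : 12 * δ ≤ ‖w‖) (hg : ‖g‖ ≤ 2 / ‖w‖)
    (hroot : d ^ 2 * g ^ 2 / 4 - w * g + 1 = 0) :
    ‖g + η * g ^ 2 - (w - η)⁻¹‖ ≤ 180 * δ ^ 2 / ‖w - η‖ ^ 3 := by
  have hw0 : 0 < ‖w‖ := by linarith
  have hwne : w ≠ 0 := norm_pos_iff.1 hw0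
  have hv := norm_sub_norm_le w η
  have hv' := norm_sub_le w η
  have hv0 : 0 < ‖w - η‖ := by linarith
  have hvne : w - η ≠ 0 := norm_pos_iff.1 hv0
  set W := ‖w‖
  set V := ‖w - η‖
  have hWV : W⁻¹ ≤ 3 / 2 * V⁻¹ := by
    rw [← div_eq_mul_inv, inv_le_comm₀ hw0 (by positivity), inv_div, div_le_iff₀ (by norm_num)]
    linarith
  have hδW : δ ≤ W / 12 := by linarith
  have h1 : ‖g - w⁻¹‖ ≤ 16 * δ ^ 2 * W⁻¹ ^ 3 := by
    have : g - w⁻¹ = d ^ 2 * g ^ 2 / 4 * w⁻¹ := by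
      field_simp
      linear_combination -4 * hroot
    rw [this, norm_mul, norm_div, norm_mul, norm_pow, norm_pow, norm_inv]
    calc ‖d‖ ^ 2 * ‖g‖ ^ 2 / ‖(4 : ℂ)‖ * W⁻¹ ≤ (4 * δ) ^ 2 * (2 / W) ^ 2 / 4 * W⁻¹ := by
          rw [norm_ofNat]; gcongr
      _ = 16 * δ ^ 2 * W⁻¹ ^ 3 := by field_simp; ring
  have h2 : ‖η * (g - w⁻¹) * (g + w⁻¹)‖ ≤ 20 * δ ^ 2 * W⁻¹ ^ 3 := by
    have h3 : ‖g + w⁻¹‖ ≤ 3 * W⁻¹ := by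
      refine (norm_add_le _ _).trans ?_
      rw [norm_inv]
      rw [div_eq_mul_inv] at hg
      linarith
    rw [norm_mul, norm_mul]
    calc ‖η‖ * ‖g - w⁻¹‖ * ‖g + w⁻¹‖ ≤ 5 * δ * (16 * δ ^ 2 * W⁻¹ ^ 3) * (3 * W⁻¹) := by gcongr
      _ = 240 * (δ * W⁻¹) * δ ^ 2 * W⁻¹ ^ 3 := by ring
      _ ≤ 240 * (1 / 12) * δ ^ 2 * W⁻¹ ^ 3 := by
          gcongr
          rw [← div_eq_mul_inv, div_le_iff₀ hw0]
          linarith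
      _ = 20 * δ ^ 2 * W⁻¹ ^ 3 := by ring
  have h3 : ‖η ^ 2 * w⁻¹ ^ 2 * (w - η)⁻¹‖ ≤ 25 * δ ^ 2 * W⁻¹ ^ 2 * V⁻¹ := by
    rw [norm_mul, norm_mul, norm_pow, norm_pow, norm_inv, norm_inv]
    calc ‖η‖ ^ 2 * W⁻¹ ^ 2 * V⁻¹ ≤ (5 * δ) ^ 2 * W⁻¹ ^ 2 * V⁻¹ := by gcongr
      _ = 25 * δ ^ 2 * W⁻¹ ^ 2 * V⁻¹ := by ring
  have hdecomp : g + η * g ^ 2 - (w - η)⁻¹ =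
      (g - w⁻¹) + η * (g - w⁻¹) * (g + w⁻¹) - η ^ 2 * w⁻¹ ^ 2 * (w - η)⁻¹ := by
    field_simp
    ring
  rw [hdecomp]
  calc _ ≤ 16 * δ ^ 2 * W⁻¹ ^ 3 + 20 * δ ^ 2 * W⁻¹ ^ 3 + 25 * δ ^ 2 * W⁻¹ ^ 2 * V⁻¹ :=
        (norm_sub_le _ _).trans (add_le_add ((norm_add_le _ _).trans (add_le_add h1 h2)) h3)
    _ ≤ 16 * δ ^ 2 * (3 / 2 * V⁻¹) ^ 3 + 20 * δ ^ 2 * (3 / 2 * V⁻¹) ^ 3 +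
        25 * δ ^ 2 * (3 / 2 * V⁻¹) ^ 2 * V⁻¹ := by gcongr
    _ = (36 * 27 / 8 + 25 * 9 / 4) * (δ ^ 2 * V⁻¹ ^ 3) := by ring
    _ ≤ 180 * (δ ^ 2 * V⁻¹ ^ 3) := by gcongr; norm_num
    _ = 180 * δ ^ 2 / V ^ 3 := by field_simp

/-- An integrable majorant, at scale `δ`, for the error in approximating the Cauchy kernel. -/
noncomputable def kernelBound (δ : ℝ) (v : ℂ) : ℝ := δ ^ 2 / (‖v‖ * (δ + ‖v‖) ^ 2)

theorem norm_quadratic_sub_inv_le_kernelBound_of_far {δ : ℝ} (hδ : 0 < δ) {g w d η : ℂ}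
    (hd : ‖d‖ ≤ 4 * δ) (hη : ‖η‖ ≤ 5 * δ) (hw : 12 * δ ≤ ‖w‖) (hg : ‖g‖ ≤ 2 / ‖w‖)
    (hroot : d ^ 2 * g ^ 2 / 4 - w * g + 1 = 0) :
    ‖g + η * g ^ 2 - (w - η)⁻¹‖ ≤ 10 ^ 10 * kernelBound δ (w - η) := by
  refine (norm_quadratic_sub_inv_le_of_far hδ hd hη hw hg hroot).trans ?_
  have hv : 7 * δ ≤ ‖w - η‖ := by linarith [norm_sub_norm_le w η]
  rw [kernelBound]
  set V := ‖w - η‖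
  have hV : 0 < V := by linarith
  rw [← mul_div_assoc, div_le_div_iff₀ (by positivity) (by positivity)]
  have : (δ + V) ^ 2 ≤ 4 * V ^ 2 := by nlinarith
  calc 180 * δ ^ 2 * (V * (δ + V) ^ 2) ≤ 180 * δ ^ 2 * (V * (4 * V ^ 2)) := by gcongr
    _ = 720 * (δ ^ 2 * V ^ 3) := by ring
    _ ≤ 10 ^ 10 * (δ ^ 2 * V ^ 3) := by gcongr; norm_num
    _ = 10 ^ 10 * δ ^ 2 * V ^ 3 := by ring

theorem norm_quadratic_sub_inv_le_kernelBound_of_near {δ : ℝ} (hδ : 0 < δ) {g v η : ℂ}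
    (hη : ‖η‖ ≤ 5 * δ) (hv0 : v ≠ 0) (hv : ‖v‖ ≤ 17 * δ) (hg : ‖g‖ ≤ 320 / δ) :
    ‖g + η * g ^ 2 - v⁻¹‖ ≤ 10 ^ 10 * kernelBound δ v := by
  have hV : 0 < ‖v‖ := norm_pos_iff.2 hv0
  have h1 : ‖g + η * g ^ 2 - v⁻¹‖ ≤ 320 / δ + 5 * δ * (320 / δ) ^ 2 + ‖v‖⁻¹ := by
    refine (norm_sub_le _ _).trans (add_le_add ((norm_add_le _ _).trans (add_le_add hg ?_))
      (norm_inv v).le)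
    rw [norm_mul, norm_pow]
    gcongr
  refine h1.trans ?_
  rw [kernelBound]
  set V := ‖v‖
  rw [← mul_div_assoc, le_div_iff₀ (by positivity)]
  calc (320 / δ + 5 * δ * (320 / δ) ^ 2 + V⁻¹) * (V * (δ + V) ^ 2)
      = (512320 * (V / δ) + 1) * (δ + V) ^ 2 := by field_simp; ring
    _ ≤ (512320 * 17 + 1) * (δ + 17 * δ) ^ 2 := by
        gcongr
        exact (div_le_iff₀ hδ).2 hv
    _ ≤ 10 ^ 10 * δ ^ 2 := by nlinarith [sq_nonneg δ]

/-- Near a boundary point of `K` the Cauchy kernel is approximated by a polynomial of degree one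
in `ζ` with coefficients in the algebra `S`. -/
theorem exists_mem_norm_sub_inv_le_kernelBound (hS : IsClosed (S : Set C(K, ℂ)))
    (hX : coordinate K ∈ S) (hK : IsPreconnected Kᶜ) {x a : ℂ} {δ : ℝ} (hδ : 0 < δ)
    (haK : a ∉ K) (hax : ‖a - x‖ < 2 * δ) :
    ∃ c : ℂ, ∃ g ∈ S, ∀ ζ : ℂ, ‖ζ - x‖ ≤ δ → ∀ z : K, (z : ℂ) ≠ ζ →
      ‖g z + (ζ - c) * g z ^ 2 - (z - ζ)⁻¹‖ ≤ 10 ^ 10 * kernelBound δ (z - ζ) := by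
  obtain ⟨b, ⟨hbK, hbx, H, hHS, hH⟩, hbfar⟩ := exists_mem_sqrtReachable hS hX hK (r := 4 * δ)
    (R := 3 * δ) (mem_ball_iff_norm.2 (by linarith : ‖a - x‖ < 4 * δ)) haK (by linarith)
  rw [mem_ball_iff_norm] at hbx
  obtain ⟨c, hc⟩ : ∃ c, c = (a + b) / 2 := ⟨_, rfl⟩
  obtain ⟨d, hd⟩ : ∃ d, d = (a - b) / 2 := ⟨_, rfl⟩
  have hd_norm : ‖d‖ = ‖a - b‖ / 2 := by rw [hd, norm_div, norm_ofNat]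
  have hab : ‖a - b‖ ≤ 8 * δ := by
    have := norm_sub_le (a - x) (b - x)
    rw [sub_sub_sub_cancel_right] at this
    linarith
  have hab' : δ ≤ ‖a - b‖ := by
    have := norm_sub_norm_le (b - x) (a - x)
    rw [sub_sub_sub_cancel_right, norm_sub_rev b a] at this
    linarith
  have hd4 : ‖d‖ ≤ 4 * δ := by linarith
  have hd2 : δ / 2 ≤ ‖d‖ := by linarith
  have hd0 : d ≠ 0 := norm_pos_iff.1 (by linarith)
  have hcx : ‖c - x‖ ≤ 4 * δ := by
    have h1 : c - x = ((a - x) + (b - x)) / 2 := by rw [hc]; ring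
    have h2 := norm_add_le (a - x) (b - x)
    rw [h1, norm_div, norm_ofNat]
    linarith
  have hconst : ∀ q : ℂ, algebraMap ℂ C(K, ℂ) q ∈ S := S.algebraMap_mem
  let g : C(K, ℂ) := algebraMap ℂ C(K, ℂ) (2 / d ^ 2) * (coordinate K - algebraMap ℂ C(K, ℂ) c -
    (coordinate K - algebraMap ℂ C(K, ℂ) b) * H)
  have hgS : g ∈ S := mul_mem (hconst _) (sub_mem (sub_mem hX (hconst _))
    (mul_mem (sub_mem hX (hconst _)) hHS))
  have hg : ∀ z : K, g z = 2 / d ^ 2 * (z - c - (z - b) * H z) := fun z ↦ rfl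
  refine ⟨c, g, hgS, fun ζ hζ z hzζ ↦ ?_⟩
  have hzb : (z : ℂ) - b ≠ 0 := sub_ne_zero.2 fun h : (z : ℂ) = b ↦ hbK (h ▸ z.2)
  have hs : ((z - b) * H z) ^ 2 = (z - a) * (z - b) := by
    rw [mul_pow, (hH z).1]
    field_simp
  have hη : ‖ζ - c‖ ≤ 5 * δ := by
    have := norm_sub_le (ζ - x) (c - x)
    rw [sub_sub_sub_cancel_right] at this
    linarith
  have tri : ∀ p : ℂ, ‖(z : ℂ) - p‖ ≤ ‖(z : ℂ) - x‖ + ‖p - x‖ := fun p ↦ by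
    simpa using norm_sub_le ((z : ℂ) - x) (p - x)
  rcases lt_or_ge ‖(z : ℂ) - x‖ (16 * δ) with hz | hz
  · refine norm_quadratic_sub_inv_le_kernelBound_of_near hδ hη (sub_ne_zero.2 hzζ)
      (by linarith [tri ζ]) ?_
    have hsn : ‖(z - b) * H z‖ ≤ 20 * δ := by
      refine (sq_le_sq₀ (norm_nonneg _) (by positivity)).1 ?_
      rw [← norm_pow, hs, norm_mul, pow_two]
      gcongr
      · linarith [tri a]
      · linarith [tri b]
    have hun : ‖(z : ℂ) - c - (z - b) * H z‖ ≤ 40 * δ := by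
      linarith [norm_sub_le ((z : ℂ) - c) ((z - b) * H z), tri c]
    rw [hg, norm_mul, norm_div, norm_ofNat, norm_pow]
    calc 2 / ‖d‖ ^ 2 * ‖(z : ℂ) - c - (z - b) * H z‖ ≤ 2 / (δ / 2) ^ 2 * (40 * δ) := by gcongr
      _ = 320 / δ := by field_simp; ring
  · have hw : 12 * δ ≤ ‖(z : ℂ) - c‖ := by
      have := norm_sub_norm_le ((z : ℂ) - x) (c - x)
      rw [sub_sub_sub_cancel_right] at this
      linarith
    have hw0 : (z : ℂ) - c ≠ 0 := norm_pos_iff.1 (by linarith)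
    have hroot : d ^ 2 * g z ^ 2 / 4 - (z - c) * g z + 1 = 0 := by
      have h1 : ((z - b) * H z) ^ 2 = (z - c) ^ 2 - d ^ 2 := by rw [hs, hc, hd]; ring
      rw [hg]
      generalize (z - b) * H z = s at h1
      field_simp
      linear_combination 4 * h1
    have hwη : (z : ℂ) - ζ = (z - c) - (ζ - c) := by ring
    rw [hwη]
    refine norm_quadratic_sub_inv_le_kernelBound_of_far hδ hd4 hη hw ?_ hroot
    have hHim : |(H z).im| < (H z).re := by
      refine abs_im_lt_re_of_sq_re_pos ?_ ((hH z).2 (by linarith))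
      rw [(hH z).1]
      refine re_div_sub_pos ?_
      have := norm_sub_norm_le ((z : ℂ) - x) (b - x)
      rw [sub_sub_sub_cancel_right] at this
      rw [norm_sub_rev]
      linarith
    have hratio : (z - b) / (z - c) = 1 + d / (z - c) := by
      rw [one_add_div hw0, hc, hd]
      ring
    have hsmall : ‖d / (z - c)‖ ≤ 1 / 3 := by
      rw [norm_div, div_le_iff₀ (by linarith)]
      linarith
    have hratio_im : |((z - b) / (z - c)).im| < ((z - b) / (z - c)).re := by
      rw [hratio, add_im, add_re, one_im, one_re, zero_add]
      have h1 := abs_im_le_norm (d / (z - c))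
      have h2 := abs_re_le_norm (d / (z - c))
      have h3 := neg_abs_le (d / (z - c)).re
      linarith
    have hre := re_mul_pos_of_abs_im_lt_re hHim hratio_im
    have hsum : ‖(z : ℂ) - c‖ ≤ ‖(z - c) + (z - b) * H z‖ := by
      have h1 : (z - c) + (z - b) * H z = (z - c) * (1 + H z * ((z - b) / (z - c))) := by
        field_simp
      have h2 : 1 ≤ ‖1 + H z * ((z - b) / (z - c))‖ := by
        refine le_trans ?_ (re_le_norm _)
        rw [add_re, one_re]
        linarith
      rw [h1, norm_mul]
      exact le_mul_of_one_le_right (norm_nonneg _) h2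
    have hsum0 : (z - c) + (z - b) * H z ≠ 0 := norm_pos_iff.1 (by linarith)
    have hgq : g z = 2 / ((z - c) + (z - b) * H z) := by
      rw [hg, eq_div_iff hsum0]
      field_simp
      have : ((z - b) * H z) ^ 2 = (z - c) ^ 2 - d ^ 2 := by rw [hs, hc, hd]; ring
      linear_combination -this
    rw [hgq, norm_div, norm_ofNat]
    gcongr

end Kernel

section CauchyPompeiu
open MeasureTheory

/-- The Wirtinger derivative with respect to the conjugate variable. -/
noncomputable def dbar (f : ℂ → ℂ) (w : ℂ) : ℂ := (fderiv ℝ f w 1 + I * fderiv ℝ f w I) / 2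

theorem integrableOn_polar_strip {G : ℝ × ℝ → ℂ} (hG : Continuous G) {R : ℝ}
    (hR : ∀ p : ℝ × ℝ, R < p.1 → G p = 0) :
    IntegrableOn G (Ioi 0 ×ˢ Ioo (-Real.pi) Real.pi) := by
  refine IntegrableOn.of_forall_sdiff_eq_zero (s := Icc 0 R ×ˢ Icc (-Real.pi) Real.pi)
    (hG.continuousOn.integrableOn_compact (isCompact_Icc.prod isCompact_Icc))
    (measurableSet_Ioi.prod measurableSet_Ioo) ?_
  rintro ⟨r, θ⟩ ⟨⟨hr, hθ⟩, h⟩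
  refine hR _ ?_
  by_contra! hle
  exact h ⟨⟨le_of_lt hr, hle⟩, Ioo_subset_Icc_self hθ⟩

variable {Φ : ℂ → ℂ}

theorem setIntegral_polar_radial (hΦ : ContDiff ℝ 1 Φ) (z : ℂ) {R : ℝ}
    (hR : ∀ w : ℂ, R < ‖w‖ → Φ (z + w) = 0 ∧ fderiv ℝ Φ (z + w) = 0) :
    IntegrableOn (fun p : ℝ × ℝ ↦ fderiv ℝ Φ (z + p.1 * exp (p.2 * I)) (exp (p.2 * I)))
      (Ioi 0 ×ˢ Ioo (-Real.pi) Real.pi) ∧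
    ∫ p : ℝ × ℝ in Ioi 0 ×ˢ Ioo (-Real.pi) Real.pi,
      fderiv ℝ Φ (z + p.1 * exp (p.2 * I)) (exp (p.2 * I)) = -(2 * Real.pi * Φ z) := by
  have hD : Continuous (fderiv ℝ Φ) := hΦ.continuous_fderiv one_ne_zero
  have hcont : Continuous
      (fun p : ℝ × ℝ ↦ fderiv ℝ Φ (z + p.1 * exp (p.2 * I)) (exp (p.2 * I))) :=
    (hD.comp (by fun_prop)).clm_apply (by fun_prop)
  have hnorm : ∀ r θ : ℝ, R < r → R < ‖r * exp (θ * I)‖ := fun r θ h ↦ by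
    rw [norm_mul, norm_exp_ofReal_mul_I, mul_one, norm_real]
    exact h.trans_le (le_abs_self r)
  have h_integrable := integrableOn_polar_strip (R := R) hcont
    fun p hp ↦ by rw [(hR _ (hnorm p.1 p.2 hp)).2]; rfl
  refine ⟨h_integrable, ?_⟩
  have hinner : ∀ θ : ℝ,
      ∫ r in Ioi (0 : ℝ), fderiv ℝ Φ (z + r * exp (θ * I)) (exp (θ * I)) = -Φ z := fun θ ↦ by
    have hderiv : ∀ r : ℝ, HasDerivAt (fun r : ℝ ↦ Φ (z + r * exp (θ * I)))
        (fderiv ℝ Φ (z + r * exp (θ * I)) (exp (θ * I))) r := fun r ↦ by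
      refine ((hΦ.differentiable one_ne_zero _).hasFDerivAt).comp_hasDerivAt r ?_
      simpa using ((hasDerivAt_id r).ofReal_comp.mul_const (exp (θ * I))).const_add z
    have hcr : Continuous fun r : ℝ ↦ fderiv ℝ Φ (z + r * exp (θ * I)) (exp (θ * I)) :=
      hcont.comp (by fun_prop : Continuous fun r : ℝ ↦ (r, θ))
    have h1 : IntegrableOn (fun r : ℝ ↦ fderiv ℝ Φ (z + r * exp (θ * I)) (exp (θ * I)))
        (Ioi 0) := by
      refine IntegrableOn.of_forall_sdiff_eq_zero (s := Icc 0 R)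
        (hcr.continuousOn.integrableOn_compact isCompact_Icc) measurableSet_Ioi ?_
      rintro r ⟨hr, h⟩
      rw [(hR _ (hnorm r θ (by by_contra! hle; exact h ⟨le_of_lt hr, hle⟩))).2]
      rfl
    have h2 : Filter.Tendsto (fun r : ℝ ↦ Φ (z + r * exp (θ * I))) Filter.atTop (𝓝 0) := by
      refine tendsto_const_nhds.congr' ?_
      filter_upwards [Filter.eventually_gt_atTop R] with r hr
      exact (hR _ (hnorm r θ hr)).1.symm
    simpa using integral_Ioi_of_hasDerivAt_of_tendsto' (fun r _ ↦ hderiv r) h1 h2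
  rw [Measure.volume_eq_prod, ← Measure.prod_restrict, integral_prod_symm _
    (by rwa [Measure.prod_restrict, ← Measure.volume_eq_prod])]
  simp only [hinner]
  rw [setIntegral_const, Measure.real, Real.volume_Ioo,
    ENNReal.toReal_ofReal (by linarith [Real.pi_pos])]
  rw [real_smul]; push_cast; ring

theorem setIntegral_polar_angular (hΦ : ContDiff ℝ 1 Φ) (z : ℂ) {R : ℝ}
    (hR : ∀ w : ℂ, R < ‖w‖ → fderiv ℝ Φ (z + w) = 0) :
    IntegrableOn (fun p : ℝ × ℝ ↦ fderiv ℝ Φ (z + p.1 * exp (p.2 * I)) (I * exp (p.2 * I)))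
      (Ioi 0 ×ˢ Ioo (-Real.pi) Real.pi) ∧
    ∫ p : ℝ × ℝ in Ioi 0 ×ˢ Ioo (-Real.pi) Real.pi,
      fderiv ℝ Φ (z + p.1 * exp (p.2 * I)) (I * exp (p.2 * I)) = 0 := by
  have hD : Continuous (fderiv ℝ Φ) := hΦ.continuous_fderiv one_ne_zero
  have hcont : Continuous
      (fun p : ℝ × ℝ ↦ fderiv ℝ Φ (z + p.1 * exp (p.2 * I)) (I * exp (p.2 * I))) :=
    (hD.comp (by fun_prop)).clm_apply (by fun_prop)
  have h_integrable := integrableOn_polar_strip (R := R) hcont fun p hp ↦ by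
    rw [hR]
    · rfl
    · rw [norm_mul, norm_exp_ofReal_mul_I, mul_one, norm_real]
      exact hp.trans_le (le_abs_self _)
  refine ⟨h_integrable, ?_⟩
  rw [Measure.volume_eq_prod] at h_integrable ⊢
  rw [setIntegral_prod _ h_integrable]
  refine setIntegral_eq_zero_of_forall_eq_zero fun r hr ↦ ?_
  have hr0 : (r : ℂ) ≠ 0 := ofReal_ne_zero.2 (ne_of_gt hr)
  have hderiv : ∀ θ : ℝ, HasDerivAt (fun θ : ℝ ↦ Φ (z + r * exp (θ * I)))
      (r * fderiv ℝ Φ (z + r * exp (θ * I)) (I * exp (θ * I))) θ := fun θ ↦ by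
    have h1 : HasDerivAt (fun θ : ℝ ↦ z + r * exp (θ * I)) (r • (I * exp (θ * I))) θ := by
      have := (((hasDerivAt_id θ).ofReal_comp.mul_const I).cexp.const_mul (r : ℂ)).const_add z
      refine this.congr_deriv ?_
      simp only [id, real_smul, ofReal_one]
      ring
    have h2 := ((hΦ.differentiable one_ne_zero _).hasFDerivAt).comp_hasDerivAt θ h1
    rwa [map_smul, real_smul] at h2
  have hcr : Continuous fun θ : ℝ ↦ r * fderiv ℝ Φ (z + r * exp (θ * I)) (I * exp (θ * I)) :=
    continuous_const.mul (hcont.comp (by fun_prop : Continuous fun θ : ℝ ↦ (r, θ)))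
  have h3 := intervalIntegral.integral_eq_sub_of_hasDerivAt (fun θ _ ↦ hderiv θ)
    (hcr.intervalIntegrable (-Real.pi) Real.pi)
  have h4 : exp (((-Real.pi : ℝ) : ℂ) * I) = exp ((Real.pi : ℂ) * I) := by
    rw [exp_pi_mul_I, ofReal_neg, neg_mul, exp_neg, exp_pi_mul_I]
    norm_num
  rw [h4, sub_self, intervalIntegral.integral_const_mul,
    intervalIntegral.integral_of_le (by linarith [Real.pi_pos]), integral_Ioc_eq_integral_Ioo] at h3
  exact (mul_eq_zero.1 h3).resolve_left hr0

/-- The **Cauchy–Pompeiu formula** for compactly supported functions. -/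
theorem integral_dbar_mul_inv_sub (hΦ : ContDiff ℝ 1 Φ) (hc : HasCompactSupport Φ) (z : ℂ) :
    ∫ w, dbar Φ w * (z - w)⁻¹ = Real.pi * Φ z := by
  obtain ⟨R, hR⟩ : ∃ R : ℝ, ∀ w : ℂ, R < ‖w‖ → Φ (z + w) = 0 ∧ fderiv ℝ Φ (z + w) = 0 := by
    obtain ⟨R, hR⟩ := hc.isCompact.isBounded.subset_closedBall z
    refine ⟨R, fun w hw ↦ ?_⟩
    have hw' : z + w ∉ tsupport Φ := fun h ↦ by
      have h1 := hR h
      rw [mem_closedBall_iff_norm, add_sub_cancel_left] at h1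
      exact absurd h1 (not_le.2 hw)
    exact ⟨image_eq_zero_of_notMem_tsupport hw', fderiv_of_notMem_tsupport ℝ hw'⟩
  obtain ⟨hi1, h1⟩ := setIntegral_polar_radial hΦ z hR
  obtain ⟨hi2, h2⟩ := setIntegral_polar_angular hΦ z fun w hw ↦ (hR w hw).2
  rw [← integral_add_left_eq_self _ z, ← Complex.integral_comp_polarCoord_symm]
  have hpt : ∀ p ∈ polarCoord.target, p.1 • (dbar Φ (z + Complex.polarCoord.symm p) *
      (z - (z + Complex.polarCoord.symm p))⁻¹) =
      -(1 / 2) * (fderiv ℝ Φ (z + p.1 * exp (p.2 * I)) (exp (p.2 * I)) +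
        I * fderiv ℝ Φ (z + p.1 * exp (p.2 * I)) (I * exp (p.2 * I))) := by
    rintro ⟨r, θ⟩ ⟨hr, -⟩
    have hr0 : (r : ℂ) ≠ 0 := ofReal_ne_zero.2 (ne_of_gt hr)
    have hsymm : Complex.polarCoord.symm (r, θ) = r * exp (θ * I) := by
      rw [Complex.polarCoord_symm_apply, exp_mul_I]
      push_cast
      rfl
    have hlin : ∀ v : ℂ, fderiv ℝ Φ (z + r * exp (θ * I)) v =
        v.re * fderiv ℝ Φ (z + r * exp (θ * I)) 1 + v.im * fderiv ℝ Φ (z + r * exp (θ * I)) I :=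
      fun v ↦ by
        have hv : v = v.re • (1 : ℂ) + v.im • I := by simp
        conv_lhs => rw [hv]
        rw [map_add, map_smul, map_smul, real_smul, real_smul]
    have hinv : (exp (θ * I))⁻¹ = Real.cos θ - Real.sin θ * I := by
      rw [← exp_neg, ← neg_mul, ← ofReal_neg, exp_mul_I, ← ofReal_cos, ← ofReal_sin, Real.cos_neg,
        Real.sin_neg, ofReal_neg]
      ring
    rw [hsymm, dbar]
    dsimp only
    rw [hlin (exp (θ * I)), hlin (I * exp (θ * I)), I_mul_re, I_mul_im, exp_ofReal_mul_I_re,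
      exp_ofReal_mul_I_im, sub_add_cancel_left, ← neg_inv, mul_inv, hinv, real_smul, ofReal_neg]
    generalize fderiv ℝ Φ (z + r * exp (θ * I)) 1 = A
    generalize fderiv ℝ Φ (z + r * exp (θ * I)) I = B
    field_simp
    linear_combination (Real.sin θ : ℂ) * B * I_sq
  rw [setIntegral_congr_fun polarCoord.open_target.measurableSet hpt, integral_const_mul]
  change _ * ∫ p : ℝ × ℝ in Ioi 0 ×ˢ Ioo (-Real.pi) Real.pi, _ = _
  rw [integral_add hi1 (hi2.const_mul I), integral_const_mul, h1, h2]
  ring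

end CauchyPompeiu

section Mollification
open MeasureTheory ContinuousLinearMap Convolution

theorem dbar_eq_zero_of_differentiableAt {f : ℂ → ℂ} {z : ℂ} (hf : DifferentiableAt ℂ f z) :
    dbar f z = 0 := by
  rw [dbar, hf.fderiv_restrictScalars ℝ, coe_restrictScalars',
    show (I : ℂ) = I • 1 by simp, map_smul]
  simp [← mul_assoc]

theorem norm_dbar_le (f : ℂ → ℂ) (z : ℂ) : ‖dbar f z‖ ≤ ‖fderiv ℝ f z‖ := by
  have h1 := (fderiv ℝ f z).le_opNorm 1
  have hI := (fderiv ℝ f z).le_opNorm I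
  rw [norm_one, mul_one] at h1
  rw [norm_I, mul_one] at hI
  rw [dbar, norm_div, Complex.norm_ofNat, div_le_iff₀ two_pos]
  refine (norm_add_le _ _).trans ?_
  rw [norm_mul, norm_I, one_mul]
  linarith

/-- Smooth averaging kernels at every scale, with gradients of the expected size. -/
theorem exists_averaging_kernel :
    ∃ M : ℝ, 0 ≤ M ∧ ∀ δ : ℝ, 0 < δ → ∃ A : ℂ → ℝ, ContDiff ℝ 1 A ∧ HasCompactSupport A ∧
      tsupport A ⊆ Metric.ball 0 δ ∧ (∀ t, 0 ≤ A t) ∧ ∫ t, A t = 1 ∧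
      ∫ t, ‖fderiv ℝ A t‖ ≤ M / δ := by
  obtain ⟨B, hB, hBc, hBs, hB0, hB1⟩ : ∃ B : ℂ → ℝ, ContDiff ℝ 1 B ∧ HasCompactSupport B ∧
      Function.support B = Metric.ball 0 (1 / 2) ∧ (∀ t, 0 ≤ B t) ∧ ∫ t, B t = 1 := by
    let φ : ContDiffBump (0 : ℂ) := ⟨1 / 4, 1 / 2, by norm_num, by norm_num⟩
    exact ⟨φ.normed volume, φ.contDiff_normed, φ.hasCompactSupport_normed, φ.support_normed_eq,
      φ.nonneg_normed, φ.integral_normed⟩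
  refine ⟨∫ t, ‖fderiv ℝ B t‖, integral_nonneg fun _ ↦ norm_nonneg _, fun δ hδ ↦
    ⟨fun t ↦ (δ ^ 2)⁻¹ * B (δ⁻¹ • t), by fun_prop, ?_, ?_, ?_, ?_, ?_⟩⟩
  · exact (hBc.comp_smul (inv_ne_zero hδ.ne')).mul_left
  · refine (closure_minimal (t := Metric.closedBall 0 (δ / 2)) (fun t ht ↦ ?_)
      Metric.isClosed_closedBall).trans (Metric.closedBall_subset_ball (by linarith))
    have h : δ⁻¹ • t ∈ Function.support B := (mul_ne_zero_iff.1 ht).2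
    rw [hBs, mem_ball_zero_iff, norm_smul, Real.norm_of_nonneg (by positivity),
      inv_mul_lt_iff₀ hδ] at h
    rw [mem_closedBall_zero_iff]
    linarith
  · exact fun t ↦ mul_nonneg (by positivity) (hB0 _)
  · rw [integral_const_mul, Measure.integral_comp_inv_smul_of_nonneg _ _ hδ.le,
      finrank_real_complex, hB1, smul_eq_mul, mul_one, inv_mul_cancel₀ (by positivity)]
  · have hd : ∀ t, fderiv ℝ (fun t ↦ (δ ^ 2)⁻¹ * B (δ⁻¹ • t)) t =
        (δ ^ 2)⁻¹ • δ⁻¹ • fderiv ℝ B (δ⁻¹ • t) := fun t ↦ by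
      have hBd : DifferentiableAt ℝ (fun t ↦ B (δ⁻¹ • t)) t :=
        ContDiffAt.differentiableAt (n := 1) (by fun_prop) one_ne_zero
      rw [fderiv_const_mul hBd, fderiv_comp_smul]
    simp_rw [hd, norm_smul]
    rw [integral_const_mul, integral_const_mul,
      Measure.integral_comp_inv_smul_of_nonneg volume (fun t ↦ ‖fderiv ℝ B t‖) hδ.le,
      finrank_real_complex, norm_inv, norm_inv, norm_pow, Real.norm_of_nonneg hδ.le, smul_eq_mul]
    apply le_of_eq
    field_simp

variable {A : ℂ → ℝ} {F : ℂ → ℂ} {δ : ℝ}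

theorem norm_fderiv_convolution_le (hA : ContDiff ℝ 1 A) (hAc : HasCompactSupport A)
    (hAs : tsupport A ⊆ Metric.ball 0 δ) (hF : Continuous F) {z : ℂ} {η : ℝ} (hη : 0 ≤ η)
    (hFη : ∀ w ∈ Metric.ball z δ, dist (F w) (F z) ≤ η) :
    ‖fderiv ℝ (A ⋆[lsmul ℝ ℝ, volume] F) z‖ ≤ (∫ t, ‖fderiv ℝ A t‖) * η := by
  let L : ℝ →L[ℝ] ℂ →L[ℝ] ℂ := lsmul ℝ ℝ
  have hconst : ∫ t, L.precompL ℂ (fderiv ℝ A t) (F z) = 0 := by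
    have h := hAc.hasFDerivAt_convolution_left (μ := volume) L hA
      (g := fun _ ↦ F z) continuous_const.locallyIntegrable z
    exact h.unique (hasFDerivAt_const _ _)
  have h := dist_convolution_le' (μ := volume) (L.precompL ℂ) hη
    ((hA.continuous_fderiv one_ne_zero).integrable_of_hasCompactSupport (hAc.fderiv ℝ))
    ((support_fderiv_subset ℝ).trans hAs) hF.aestronglyMeasurable hFη
  rw [hconst, dist_zero_right] at h
  rw [(hAc.hasFDerivAt_convolution_left L hA hF.locallyIntegrable z).fderiv]
  refine h.trans ?_
  gcongr
  refine mul_le_of_le_one_left (integral_nonneg fun _ ↦ norm_nonneg _) ?_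
  exact (norm_precompL_le _ _).trans opNorm_lsmul_le

theorem differentiableAt_convolution (hA : Continuous A) (hAc : HasCompactSupport A)
    (hAs : tsupport A ⊆ Metric.ball 0 δ) (hF : Continuous F) {U : Set ℂ} (hU : IsOpen U)
    (hFU : DifferentiableOn ℂ F U) {z : ℂ} (hz : Metric.closedBall z δ ⊆ U) :
    DifferentiableAt ℂ (A ⋆[lsmul ℝ ℝ, volume] F) z := by
  obtain ⟨r, hr, hrU⟩ := (isCompact_closedBall z δ).exists_cthickening_subset_open hU hz
  have hmem : ∀ t ∈ Function.support A, ∀ x ∈ Metric.ball z r,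
      x - t ∈ Metric.cthickening r (Metric.closedBall z δ) := fun t ht x hx ↦ by
    refine Metric.mem_cthickening_of_dist_le _ (z - t) _ _ ?_ ?_
    · simpa using (mem_ball_zero_iff.1 (hAs (subset_tsupport A ht))).le
    · simpa [dist_eq_norm] using (Metric.mem_ball.1 hx).le
  obtain ⟨C, hC⟩ := (isCompact_closedBall z δ).cthickening.exists_bound_of_continuousOn
    ((hFU.deriv hU).continuousOn.mono hrU)
  have hcont : ∀ x, Continuous fun t ↦ A t • F (x - t) := fun x ↦ by fun_prop
  refine (hasDerivAt_integral_of_dominated_loc_of_deriv_le (𝕜 := ℂ) (μ := volume)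
    (F := fun x t ↦ A t • F (x - t)) (F' := fun x t ↦ A t • deriv F (x - t))
    (bound := fun t ↦ ‖A t‖ * C)
    (Metric.ball_mem_nhds z hr) (.of_forall fun x ↦ (hcont x).aestronglyMeasurable)
    ((hcont z).integrable_of_hasCompactSupport hAc.smul_right) ?_ (.of_forall fun t x hx ↦ ?_)
    ((hA.integrable_of_hasCompactSupport hAc).norm.mul_const C)
    (.of_forall fun t x hx ↦ ?_)).2.differentiableAt
  · have : Measurable fun t ↦ deriv F (z - t) := (measurable_deriv F).comp (by fun_prop)
    exact (hA.measurable.smul this).aestronglyMeasurable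
  · rw [norm_smul]
    by_cases ht : A t = 0
    · simp [ht]
    · gcongr
      exact hC _ (hmem t ht x hx)
  · by_cases ht : A t = 0
    · simpa [ht] using hasDerivAt_const x (0 : ℂ)
    · have hd := hFU.differentiableAt (hU.mem_nhds (hrU (hmem t ht x hx)))
      exact (hd.hasDerivAt.comp_sub_const x t).const_smul (A t)

/-- Approximation of a continuous function, holomorphic on `U`, by `C¹` functions with controlled
`dbar` vanishing at points of `U` far from the boundary. -/
theorem exists_contDiff_approx : ∃ M : ℝ, 0 ≤ M ∧ ∀ (F : ℂ → ℂ) (U : Set ℂ) (δ η : ℝ),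
    Continuous F → HasCompactSupport F → IsOpen U → DifferentiableOn ℂ F U → 0 < δ → 0 ≤ η →
    (∀ z w, dist w z < δ → dist (F w) (F z) ≤ η) →
    ∃ Φ : ℂ → ℂ, ContDiff ℝ 1 Φ ∧ HasCompactSupport Φ ∧ (∀ z, ‖Φ z - F z‖ ≤ η) ∧
      (∀ z, ‖dbar Φ z‖ ≤ M / δ * η) ∧ ∀ z, Metric.closedBall z δ ⊆ U → dbar Φ z = 0 := by
  obtain ⟨M, hM, h⟩ := exists_averaging_kernel
  refine ⟨M, hM, fun F U δ η hF hFc hU hFU hδ hη hFη ↦ ?_⟩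
  obtain ⟨A, hA, hAc, hAs, hA0, hA1, hAM⟩ := h δ hδ
  refine ⟨A ⋆[lsmul ℝ ℝ, volume] F, hAc.contDiff_convolution_left _ hA hF.locallyIntegrable,
    hAc.convolution _ hFc, fun z ↦ ?_, fun z ↦ ?_, fun z hz ↦ ?_⟩
  · rw [← dist_eq_norm]
    exact dist_convolution_le hη ((subset_tsupport A).trans hAs) hA0 hA1
      hF.aestronglyMeasurable fun w hw ↦ hFη z w hw
  · refine (norm_dbar_le _ _).trans ?_
    refine (norm_fderiv_convolution_le hA hAc hAs hF hη fun w hw ↦ hFη z w hw).trans ?_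
    gcongr
  · exact dbar_eq_zero_of_differentiableAt
      (differentiableAt_convolution hA.continuous hAc hAs hF hU hFU hz)

end Mollification

section Assembly
open MeasureTheory

theorem kernelBound_nonneg (δ : ℝ) (v : ℂ) : 0 ≤ kernelBound δ v := by
  unfold kernelBound
  positivity

theorem kernelBound_eq_smul {δ : ℝ} (hδ : 0 < δ) (v : ℂ) :
    kernelBound δ v = δ⁻¹ * kernelBound 1 (δ⁻¹ • v) := by
  rcases eq_or_ne v 0 with rfl | hv
  · simp [kernelBound]
  · have hv' : 0 < ‖v‖ := norm_pos_iff.2 hv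
    rw [kernelBound, kernelBound, norm_smul, Real.norm_of_nonneg (by positivity)]
    field_simp

theorem integrable_kernelBound {δ : ℝ} (hδ : 0 < δ) : Integrable (kernelBound δ) := by
  have h1 : Integrable (kernelBound 1) := by
    refine (integrable_fun_norm_addHaar (E := ℂ) volume
      (f := fun r : ℝ ↦ 1 ^ 2 / (r * (1 + r) ^ 2))).2 ?_
    refine (integrableOn_add_rpow_Ioi_of_lt (a := -2) (m := 1) (by norm_num)
      (by norm_num)).congr_fun (fun r hr ↦ ?_) measurableSet_Ioi
    have hr' : (0 : ℝ) < r := hr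
    beta_reduce
    rw [finrank_real_complex, Real.rpow_neg (by positivity), Real.rpow_two, smul_eq_mul, pow_one]
    field_simp
    ring
  rw [funext (kernelBound_eq_smul hδ)]
  exact (h1.comp_smul (inv_ne_zero hδ.ne')).const_mul _

theorem integral_kernelBound {δ : ℝ} (hδ : 0 < δ) :
    ∫ v, kernelBound δ v = δ * ∫ v, kernelBound 1 v := by
  rw [funext (kernelBound_eq_smul hδ), integral_const_mul,
    Measure.integral_comp_inv_smul_of_nonneg _ _ hδ.le, finrank_real_complex, smul_eq_mul]
  field_simp

theorem norm_inv_le_kernelBound {R : ℝ} (hR : 0 < R) {v : ℂ} (hv : ‖v‖ ≤ R) :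
    ‖v⁻¹‖ ≤ 4 * kernelBound R v := by
  rcases eq_or_ne v 0 with rfl | hv0
  · simp [kernelBound]
  · have hv' : 0 < ‖v‖ := norm_pos_iff.2 hv0
    rw [kernelBound, norm_inv, ← mul_div_assoc, le_div_iff₀ (by positivity),
      inv_mul_cancel_left₀ hv'.ne']
    nlinarith

variable {μ : ℂ → ℂ}

theorem integrable_mul_inv_sub (hμ : Continuous μ) (hμc : HasCompactSupport μ) (z : ℂ) :
    Integrable fun ζ ↦ μ ζ * (z - ζ)⁻¹ := by
  obtain ⟨m, hm⟩ := hμc.exists_bound_of_continuous hμ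
  obtain ⟨R, hR, hμR⟩ := hμc.isCompact.isBounded.subset_closedBall_lt 0 z
  have h_integrable := (((integrable_kernelBound hR).comp_sub_left z).const_mul 4).const_mul m
  refine h_integrable.mono' (by fun_prop) (.of_forall fun ζ ↦ ?_)
  have hm0 : 0 ≤ m := (norm_nonneg _).trans (hm ζ)
  by_cases hζ : ζ ∈ tsupport μ
  · rw [norm_mul]
    gcongr
    · exact hm ζ
    · exact norm_inv_le_kernelBound hR (by simpa [dist_eq_norm, norm_sub_rev] using hμR hζ)
  · rw [image_eq_zero_of_notMem_tsupport hζ, zero_mul, norm_zero]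
    have := kernelBound_nonneg R (z - ζ)
    positivity

theorem integrable_norm_mul_kernelBound (hμ : Continuous μ) (hμc : HasCompactSupport μ) {δ : ℝ}
    (hδ : 0 < δ) (z : ℂ) : Integrable fun ζ ↦ ‖μ ζ‖ * kernelBound δ (z - ζ) := by
  obtain ⟨m, hm⟩ := hμc.exists_bound_of_continuous hμ
  exact ((integrable_kernelBound hδ).comp_sub_left z).bdd_mul (c := m)
    hμ.norm.aestronglyMeasurable (.of_forall fun ζ ↦ by simpa using hm ζ)

variable {K : Set ℂ} [CompactSpace K] {S : Subalgebra ℂ C(K, ℂ)}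

/-- Cauchy transforms of densities concentrated near the complement of `K` are
approximated by members of `S`. -/
theorem exists_mem_norm_sub_cauchyTransform_le (hS : IsClosed (S : Set C(K, ℂ)))
    (hX : coordinate K ∈ S) (hK : IsPreconnected Kᶜ) (hμ : Continuous μ)
    (hμc : HasCompactSupport μ) {δ : ℝ} (hδ : 0 < δ) {Z : Set ℂ} (hZ : IsCompact Z)
    (hZK : ∀ x ∈ Z, ∃ a ∉ K, ‖a - x‖ < 2 * δ) :
    ∃ φ ∈ S, ∀ z : K, ‖φ z - ∫ ζ in Z, μ ζ * (z - ζ)⁻¹‖ ≤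
      ∫ ζ in Z, 10 ^ 10 * (‖μ ζ‖ * kernelBound δ (z - ζ)) := by
  have hinv := integrable_mul_inv_sub hμ hμc
  have hker := fun z ↦ (integrable_norm_mul_kernelBound hμ hμc hδ z).const_mul (10 ^ 10)
  suffices h : ∃ s, Z ⊆ s ∧ MeasurableSet s ∧ ∀ Y ⊆ s, MeasurableSet Y →
      ∃ φ ∈ S, ∀ z : K, ‖φ z - ∫ ζ in Y, μ ζ * (z - ζ)⁻¹‖ ≤
        ∫ ζ in Y, 10 ^ 10 * (‖μ ζ‖ * kernelBound δ (z - ζ)) by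
    obtain ⟨s, hZs, -, h⟩ := h
    exact h Z hZs hZ.measurableSet
  refine hZ.induction_on (p := fun Z ↦ ∃ s, Z ⊆ s ∧ MeasurableSet s ∧ ∀ Y ⊆ s, MeasurableSet Y →
      ∃ φ ∈ S, ∀ z : K, ‖φ z - ∫ ζ in Y, μ ζ * (z - ζ)⁻¹‖ ≤
        ∫ ζ in Y, 10 ^ 10 * (‖μ ζ‖ * kernelBound δ (z - ζ))) ?_ ?_ ?_ ?_
  · refine ⟨∅, subset_rfl, .empty, fun Y hY _ ↦ ⟨0, S.zero_mem, fun z ↦ ?_⟩⟩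
    simp [subset_empty_iff.1 hY]
  · rintro s t hst ⟨s', hs', h⟩
    exact ⟨s', hst.trans hs', h⟩
  · rintro s t ⟨s', hs', hs'm, hs⟩ ⟨t', ht', ht'm, ht⟩
    refine ⟨s' ∪ t', union_subset_union hs' ht', hs'm.union ht'm, fun Y hY hYm ↦ ?_⟩
    obtain ⟨φ, hφ, hφY⟩ := hs (Y ∩ s') inter_subset_right (hYm.inter hs'm)
    obtain ⟨ψ, hψ, hψY⟩ := ht (Y \ s') (fun w hw ↦ (hY hw.1).resolve_left hw.2) (hYm.diff hs'm)
    refine ⟨φ + ψ, S.add_mem hφ hψ, fun z ↦ ?_⟩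
    rw [← integral_inter_add_sdiff hs'm (hinv z).integrableOn,
      ← integral_inter_add_sdiff hs'm (hker z).integrableOn, ContinuousMap.add_apply,
      add_sub_add_comm]
    exact (norm_add_le _ _).trans (add_le_add (hφY z) (hψY z))
  · intro x hx
    obtain ⟨a, haK, hax⟩ := hZK x hx
    obtain ⟨c, g, hg, hgx⟩ := exists_mem_norm_sub_inv_le_kernelBound hS hX hK hδ haK hax
    refine ⟨Metric.closedBall x δ, mem_nhdsWithin_of_mem_nhds (Metric.closedBall_mem_nhds x hδ),
      Metric.closedBall x δ, subset_rfl, measurableSet_closedBall, fun Y hY hYm ↦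
      ⟨(∫ ζ in Y, μ ζ) • g + (∫ ζ in Y, μ ζ * (ζ - c)) • g ^ 2,
        S.add_mem (S.smul_mem hg _) (S.smul_mem (pow_mem hg 2) _), fun z ↦ ?_⟩⟩
    have hi0 : IntegrableOn μ Y := (hμ.integrable_of_hasCompactSupport hμc).integrableOn
    have hi1 : IntegrableOn (fun ζ ↦ μ ζ * (ζ - c)) Y :=
      (Continuous.integrable_of_hasCompactSupport (by fun_prop) hμc.mul_right).integrableOn
    have heq : ((∫ ζ in Y, μ ζ) • g + (∫ ζ in Y, μ ζ * (ζ - c)) • g ^ 2) z -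
        ∫ ζ in Y, μ ζ * (z - ζ)⁻¹ =
        ∫ ζ in Y, μ ζ * (g z + (ζ - c) * g z ^ 2 - (z - ζ)⁻¹) := by
      have : ∀ ζ, μ ζ * (g z + (ζ - c) * g z ^ 2 - (z - ζ)⁻¹) =
          μ ζ * g z + μ ζ * (ζ - c) * g z ^ 2 - μ ζ * (z - ζ)⁻¹ := fun ζ ↦ by ring
      simp_rw [this]
      rw [integral_sub (by exact (hi0.mul_const _).add (hi1.mul_const _)) (hinv z).integrableOn,
        integral_add (hi0.mul_const _) (hi1.mul_const _), integral_mul_const, integral_mul_const]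
      simp
    rw [heq]
    refine norm_integral_le_of_norm_le (hker z).integrableOn ?_
    have hne : ∀ᵐ ζ ∂volume.restrict Y, ζ ≠ (z : ℂ) :=
      ae_restrict_of_ae (compl_mem_ae_iff.2 (measure_singleton _))
    filter_upwards [ae_restrict_mem hYm, hne] with ζ hζY hζ
    rw [norm_mul, mul_left_comm]
    gcongr
    exact hgx ζ (by simpa [dist_eq_norm] using hY hζY) z hζ.symm

/-- **Mergelyan's theorem**, for closed algebras of functions containing the coordinate. -/
theorem mem_of_differentiableOn_interior (hS : IsClosed (S : Set C(K, ℂ)))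
    (hX : coordinate K ∈ S) (hK : IsPreconnected Kᶜ) {F : ℂ → ℂ} (hF : Continuous F)
    (hFc : HasCompactSupport F) (hFd : DifferentiableOn ℂ F (interior K)) {f : C(K, ℂ)}
    (hf : ∀ z : K, f z = F z) : f ∈ S := by
  obtain ⟨M, hM, happrox⟩ := exists_contDiff_approx
  have hk : 0 ≤ ∫ v, kernelBound 1 v := integral_nonneg (kernelBound_nonneg 1)
  set C : ℝ := 10 ^ 10 * M * ∫ v, kernelBound 1 v with hCdef
  have hC : 0 ≤ C := by positivity
  refine hS.closure_subset (Metric.mem_closure_iff.2 fun ε hε ↦ ?_)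
  obtain ⟨η, hη, hηε⟩ : ∃ η : ℝ, 0 < η ∧ (1 + C) * η < ε := exists_pos_mul_lt hε _
  obtain ⟨δ, hδ, hFδ⟩ := Metric.uniformContinuous_iff.1
    (hF.uniformContinuous_of_tendsto_cocompact hFc.is_zero_at_infty) η hη
  obtain ⟨Φ, hΦ, hΦc, hΦF, hΦd, hΦ0⟩ := happrox F (interior K) δ η hF hFc isOpen_interior hFd hδ
    hη.le fun z w h ↦ (hFδ h).le
  have hμ : Continuous (dbar Φ) := by
    have := hΦ.continuous_fderiv one_ne_zero
    unfold dbar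
    fun_prop
  have hμs : Function.support (dbar Φ) ⊆ tsupport Φ := fun z hz ↦ by
    by_contra h
    refine hz ?_
    have := Function.notMem_support.1 fun h' ↦ h (support_fderiv_subset ℝ h')
    simp [dbar, this]
  have hμc : HasCompactSupport (dbar Φ) := hΦc.mono' hμs
  let Z : Set ℂ := tsupport Φ ∩ Metric.cthickening δ (interior K)ᶜ
  have hZ : IsCompact Z := hΦc.isCompact.inter_right Metric.isClosed_cthickening
  have hZ0 : ∀ ζ ∉ Z, dbar Φ ζ = 0 := fun ζ hζ ↦ by
    by_contra hne
    refine hne (hΦ0 ζ fun w hw ↦ ?_)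
    by_contra hwK
    exact hζ ⟨hμs hne, Metric.mem_cthickening_of_dist_le _ w _ _ hwK (by rwa [dist_comm])⟩
  have hZK : ∀ x ∈ Z, ∃ a ∉ K, ‖a - x‖ < 2 * δ := by
    intro x hx
    obtain ⟨b, hb, hxb⟩ := Metric.mem_thickening_iff.1
      (Metric.cthickening_subset_thickening' (by linarith) (by linarith : δ < 2 * δ) _ hx.2)
    rw [← closure_compl] at hb
    obtain ⟨a, haK, hba⟩ := Metric.mem_closure_iff.1 hb (2 * δ - dist x b) (by linarith)
    refine ⟨a, haK, ?_⟩
    rw [← dist_eq_norm, dist_comm]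
    linarith [dist_triangle x b a]
  obtain ⟨φ, hφ, hφΦ⟩ := exists_mem_norm_sub_cauchyTransform_le hS hX hK hμ hμc hδ hZ hZK
  refine ⟨(Real.pi : ℂ)⁻¹ • φ, S.smul_mem hφ _, lt_of_le_of_lt ?_ hηε⟩
  rw [dist_eq_norm]
  refine (ContinuousMap.norm_le _ (by positivity)).2 fun z ↦ ?_
  have hbound : ‖φ z - Real.pi * Φ z‖ ≤ C * η := by
    rw [← integral_dbar_mul_inv_sub hΦ hΦc, ← setIntegral_eq_integral_of_forall_compl_eq_zero
      (s := Z) fun ζ hζ ↦ by rw [hZ0 ζ hζ, zero_mul]]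
    refine (hφΦ z).trans ?_
    have h_integrable := ((integrable_kernelBound hδ).comp_sub_left (z : ℂ)).const_mul
      (10 ^ 10 * (M / δ * η))
    calc ∫ ζ in Z, 10 ^ 10 * (‖dbar Φ ζ‖ * kernelBound δ (z - ζ))
        ≤ ∫ ζ, 10 ^ 10 * (‖dbar Φ ζ‖ * kernelBound δ (z - ζ)) :=
          setIntegral_le_integral
            ((integrable_norm_mul_kernelBound hμ hμc hδ z).const_mul (10 ^ 10))
            (.of_forall fun ζ ↦ by
              have := kernelBound_nonneg δ (z - ζ)
              positivity)
      _ ≤ ∫ ζ, 10 ^ 10 * (M / δ * η) * kernelBound δ (z - ζ) := by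
          refine integral_mono
            ((integrable_norm_mul_kernelBound hμ hμc hδ z).const_mul (10 ^ 10)) h_integrable
            fun ζ ↦ ?_
          have := kernelBound_nonneg δ (z - ζ)
          have := hΦd ζ
          dsimp only
          rw [mul_assoc]
          gcongr
      _ = C * η := by
          rw [integral_const_mul, integral_sub_left_eq_self (kernelBound δ),
            integral_kernelBound hδ, hCdef]
          field_simp
  have hπ : (Real.pi : ℂ) ≠ 0 := ofReal_ne_zero.2 Real.pi_ne_zero
  have heq : (f - (Real.pi : ℂ)⁻¹ • φ) z =
      -(Φ z - F z) - (Real.pi : ℂ)⁻¹ * (φ z - Real.pi * Φ z) := by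
    rw [ContinuousMap.sub_apply, ContinuousMap.smul_apply, hf, smul_eq_mul]
    field_simp
    ring
  have hπ1 : ‖(Real.pi : ℂ)⁻¹‖ ≤ 1 := by
    rw [norm_inv, norm_real, Real.norm_of_nonneg Real.pi_pos.le]
    exact inv_le_one_of_one_le₀ (by linarith [Real.pi_gt_three])
  calc ‖(f - (Real.pi : ℂ)⁻¹ • φ) z‖
      ≤ ‖Φ z - F z‖ + ‖(Real.pi : ℂ)⁻¹‖ * ‖φ z - Real.pi * Φ z‖ := by
        rw [heq, ← norm_mul, ← norm_neg (Φ z - F z)]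
        exact norm_sub_le _ _
    _ ≤ η + 1 * (C * η) := by
        gcongr
        exact hΦF z
    _ = (1 + C) * η := by ring

end Assembly

section Interpolation

theorem exists_differentiable_eq_prod_mul (s : Finset ℂ) {F : ℂ → ℂ} (hF : Differentiable ℂ F)
    (hs : ∀ a ∈ s, F a = 0) :
    ∃ G : ℂ → ℂ, Differentiable ℂ G ∧ ∀ w, F w = (∏ a ∈ s, (w - a)) * G w := by
  induction s using Finset.induction_on with
  | empty => exact ⟨F, hF, by simp⟩
  | insert a s has ih =>
    obtain ⟨G, hG, hFG⟩ := ih fun b hb ↦ hs b (Finset.mem_insert_of_mem hb)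
    have hGa : G a = 0 := by
      have h := hFG a
      rw [hs a (Finset.mem_insert_self a s), eq_comm, mul_eq_zero] at h
      refine h.resolve_left (Finset.prod_ne_zero_iff.2 fun b hb ↦ sub_ne_zero.2 ?_)
      rintro rfl
      exact has hb
    refine ⟨dslope G a, ?_, fun w ↦ ?_⟩
    · rw [← differentiableOn_univ] at hG ⊢
      exact (Complex.differentiableOn_dslope Filter.univ_mem).2 hG
    · have := sub_smul_dslope G a w
      rw [hGa, sub_zero, smul_eq_mul] at this
      rw [hFG, Finset.prod_insert has, ← this]
      ring

theorem norm_le_of_zeros {F : ℂ → ℂ} (hF : Differentiable ℂ F) {s : Finset ℂ} {L B : ℝ}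
    (hL : 1 ≤ L) (hsL : ∀ a ∈ s, ‖a‖ ≤ L) (hs : ∀ a ∈ s, F a = 0)
    (hB : ∀ w, ‖w‖ = 5 * L → ‖F w‖ ≤ B) {w : ℂ} (hw : ‖w‖ ≤ 1) :
    ‖F w‖ ≤ B / 2 ^ s.card := by
  obtain ⟨G, hG, hFG⟩ := exists_differentiable_eq_prod_mul s hF hs
  have hGw : ‖G w‖ ≤ B / (4 * L) ^ s.card := by
    refine Complex.norm_le_of_forall_mem_frontier_norm_le (U := Metric.ball 0 (5 * L))
      Metric.isBounded_ball hG.diffContOnCl (fun v hv ↦ ?_)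
      (subset_closure (mem_ball_zero_iff.2 (by linarith)))
    rw [frontier_ball _ (by positivity), mem_sphere_zero_iff_norm] at hv
    have hprod : (4 * L) ^ s.card ≤ ∏ a ∈ s, ‖v - a‖ := by
      rw [← Finset.prod_const]
      refine Finset.prod_le_prod (fun _ _ ↦ by positivity) fun a ha ↦ ?_
      linarith [norm_sub_norm_le v a, hsL a ha]
    rw [le_div_iff₀ (by positivity)]
    calc ‖G v‖ * (4 * L) ^ s.card ≤ ‖G v‖ * ∏ a ∈ s, ‖v - a‖ := by gcongr
      _ = ‖F v‖ := by rw [hFG, norm_mul, norm_prod, mul_comm]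
      _ ≤ B := hB v hv
  have hprod : ∏ a ∈ s, ‖w - a‖ ≤ (2 * L) ^ s.card := by
    rw [← Finset.prod_const]
    refine Finset.prod_le_prod (fun _ _ ↦ norm_nonneg _) fun a ha ↦ ?_
    linarith [norm_sub_le w a, hsL a ha]
  calc ‖F w‖ = (∏ a ∈ s, ‖w - a‖) * ‖G w‖ := by rw [hFG, norm_mul, norm_prod]
    _ ≤ (2 * L) ^ s.card * (B / (4 * L) ^ s.card) := by gcongr
    _ = B / 2 ^ s.card := by
      rw [show 4 * L = 2 * (2 * L) by ring, mul_pow 2 (2 * L)]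
      field_simp

/-- An entire function of exponential type vanishing at all `log k` is zero. -/
theorem eq_zero_of_forall_log_eq_zero {F : ℂ → ℂ} (hF : Differentiable ℂ F) {A R : ℝ}
    (hA : ∀ w, ‖F w‖ ≤ A * Real.exp (R * ‖w‖)) (h0 : ∀ k : ℕ, 1 ≤ k → F (Real.log k) = 0) {w : ℂ}
    (hw : ‖w‖ ≤ 1) : F w = 0 := by
  have hbound : ∀ᶠ N : ℕ in Filter.atTop,
      ‖F w‖ ≤ A * ((N : ℝ) ^ (5 * R) * Real.exp (-Real.log 2 * N)) := by
    filter_upwards [Filter.eventually_ge_atTop 3] with N hN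
    have hN0 : (0 : ℝ) < N := by positivity
    have hL : 1 ≤ Real.log N := by
      rw [Real.le_log_iff_exp_le hN0]
      have : (3 : ℝ) ≤ N := by exact_mod_cast hN
      linarith [Real.exp_one_lt_d9]
    have hinj : Set.InjOn (fun k : ℕ ↦ ((Real.log k : ℝ) : ℂ)) (Finset.Icc 1 N) := by
      intro j hj k hk h
      rw [Finset.coe_Icc] at hj hk
      have hpos : ∀ i : ℕ, 1 ≤ i → (i : ℝ) ∈ Ioi 0 := fun i hi ↦ mem_Ioi.2 (Nat.cast_pos.2 hi)
      exact Nat.cast_injective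
        (Real.log_injOn_pos (hpos j hj.1) (hpos k hk.1) (ofReal_injective h))
    have := norm_le_of_zeros hF (s := (Finset.Icc 1 N).image fun k : ℕ ↦ ((Real.log k : ℝ) : ℂ)) hL
      (by
        simp only [Finset.mem_image, Finset.mem_Icc]
        rintro _ ⟨k, ⟨hk1, hkN⟩, rfl⟩
        have hk1' : (1 : ℝ) ≤ k := by exact_mod_cast hk1
        rw [norm_real, Real.norm_of_nonneg (Real.log_nonneg hk1')]
        exact Real.log_le_log (by linarith) (by exact_mod_cast hkN))
      (by
        simp only [Finset.mem_image, Finset.mem_Icc]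
        rintro _ ⟨k, ⟨hk1, -⟩, rfl⟩
        exact h0 k hk1)
      (B := A * Real.exp (R * (5 * Real.log N))) (fun v hv ↦ hv ▸ hA v) hw
    rw [Finset.card_image_of_injOn hinj, Nat.card_Icc, Nat.add_sub_cancel] at this
    refine this.trans_eq ?_
    rw [Real.rpow_def_of_pos hN0, neg_mul, Real.exp_neg, mul_comm (Real.log 2), Real.exp_nat_mul,
      Real.exp_log two_pos]
    ring_nf
  have hlim := ((tendsto_rpow_mul_exp_neg_mul_atTop_nhds_zero (5 * R) (Real.log 2)
    (Real.log_pos one_lt_two)).comp tendsto_natCast_atTop_atTop).const_mul A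
  rw [mul_zero] at hlim
  exact norm_le_zero_iff.1 (ge_of_tendsto hlim hbound)

end Interpolation

section Dirichlet

variable (K : Set ℂ)

/-- The monomial `z ↦ k ^ (-z)` on `K`, depending multiplicatively on `k`. -/
noncomputable def dirichletMonomial : ℕ+ →* C(K, ℂ) where
  toFun k := ⟨fun z ↦ (k : ℂ) ^ (-z : ℂ),
    Continuous.const_cpow (by fun_prop) (.inl (Nat.cast_ne_zero.2 k.ne_zero))⟩
  map_one' := by ext z; simp
  map_mul' j k := by
    ext z
    simpa using natCast_mul_natCast_cpow j k (-z)

/-- The algebra of restrictions to `K` of Dirichlet polynomials. -/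
noncomputable def dirichletAlgebra : Subalgebra ℂ C(K, ℂ) :=
  Algebra.adjoin ℂ (MonoidHom.mrange (dirichletMonomial K) : Set C(K, ℂ))

variable {K}

theorem exists_isDirichletPolynomial_of_mem {φ : C(K, ℂ)} (hφ : φ ∈ dirichletAlgebra K) :
    ∃ D : ℂ → ℂ, IsDirichletPolynomial D ∧ ∀ z : K, φ z = D z := by
  have h : φ ∈ Submodule.span ℂ (Set.range (dirichletMonomial K)) := by
    rw [dirichletAlgebra, ← Subalgebra.mem_toSubmodule, Algebra.adjoin_eq_span,
      Submonoid.closure_eq] at hφ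
    exact hφ
  obtain ⟨c, rfl⟩ := (Finsupp.mem_span_range_iff_exists_finsupp).1 h
  refine ⟨_, ⟨c.support.sup (fun k ↦ (k : ℕ)), fun k ↦ c k.toPNat',
    fun z ↦ rfl⟩, fun z ↦ ?_⟩
  rw [Finsupp.sum, ContinuousMap.sum_apply]
  symm
  refine Finset.sum_of_injOn (fun k : ℕ+ ↦ (k : ℕ)) ?_ ?_ ?_ ?_ |>.symm
  · exact PNat.coe_injective.injOn
  · intro k hk
    simp only [Finset.coe_Icc, mem_Icc]
    exact ⟨k.pos, Finset.le_sup (f := fun k : ℕ+ ↦ (k : ℕ)) hk⟩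
  · intro k hk hk'
    have hk0 : (k.toPNat' : ℕ) = k := PNat.toPNat'_coe (Finset.mem_Icc.1 hk).1
    have hck : c k.toPNat' = 0 := Finsupp.notMem_support_iff.1 fun hs ↦ hk' ⟨_, hs, hk0⟩
    simp [hck]
  · intro k _
    simp [dirichletMonomial]

theorem coordinate_mem_topologicalClosure_dirichletAlgebra [CompactSpace K] :
    coordinate K ∈ (dirichletAlgebra K).topologicalClosure := by
  by_contra hX
  set V : Submodule ℂ C(K, ℂ) := Subalgebra.toSubmodule (dirichletAlgebra K).topologicalClosure
  have hVc : IsClosed (V : Set C(K, ℂ)) := Subalgebra.isClosed_topologicalClosure _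
  obtain ⟨ℓ, hℓX, hℓV⟩ : ∃ ℓ : StrongDual ℂ C(K, ℂ), ℓ (coordinate K) ≠ 0 ∧ ∀ v ∈ V, ℓ v = 0 := by
    obtain ⟨ℓ, u, hℓV, hℓX⟩ := RCLike.geometric_hahn_banach_closed_point (𝕜 := ℂ)
      (V.restrictScalars ℝ).convex hVc hX
    have hu : 0 < u := by simpa using hℓV 0 V.zero_mem
    refine ⟨ℓ, fun h ↦ ?_, fun v hv ↦ ?_⟩
    · rw [h, map_zero] at hℓX
      exact hu.not_gt hℓX
    · by_contra hne
      have := hℓV (((u : ℂ) / ℓ v) • v) (V.smul_mem _ hv)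
      rw [map_smul, smul_eq_mul, div_mul_cancel₀ _ hne] at this
      simp at this
  have hmono : ∀ k : ℕ+, dirichletMonomial K k ∈ V := fun k ↦
    Subalgebra.le_topologicalClosure _ (Algebra.subset_adjoin ⟨k, rfl⟩)
  let F : ℂ → ℂ := fun w ↦ ℓ (NormedSpace.exp (w • -coordinate K))
  have hexp : ∀ w : ℂ, HasDerivAt F
      (ℓ (NormedSpace.exp (w • -coordinate K) * -coordinate K)) w := fun w ↦
    ℓ.hasFDerivAt.comp_hasDerivAt w (hasDerivAt_exp_smul_const (-coordinate K) w)
  have hF : Differentiable ℂ F := fun w ↦ (hexp w).differentiableAt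
  have hexp_apply : ∀ (w : ℂ) (z : K),
      NormedSpace.exp (w • -coordinate K) z = exp (-(w * z)) := fun w z ↦ by
    have := NormedSpace.map_exp (ContinuousMap.evalAlgHom ℂ ℂ z)
      (continuous_eval_const z) (w • -coordinate K)
    rw [← Complex.exp_eq_exp_ℂ] at this
    simpa [coordinate] using this
  have hA : ∀ w, ‖F w‖ ≤ ‖ℓ‖ * Real.exp (‖coordinate K‖ * ‖w‖) := fun w ↦ by
    refine (ℓ.le_opNorm _).trans ?_
    gcongr
    refine (ContinuousMap.norm_le _ (Real.exp_pos _).le).2 fun z ↦ ?_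
    rw [hexp_apply, norm_exp]
    gcongr
    refine (re_le_norm _).trans ?_
    rw [norm_neg, norm_mul, mul_comm]
    gcongr
    exact (coordinate K).norm_coe_le_norm z
  have h0 : ∀ k : ℕ, 1 ≤ k → F (Real.log k) = 0 := fun k hk ↦ by
    have : NormedSpace.exp (((Real.log k : ℝ) : ℂ) • -coordinate K) =
        dirichletMonomial K ⟨k, hk⟩ := by
      ext z
      have hk0 : (k : ℂ) ≠ 0 := Nat.cast_ne_zero.2 (by lia)
      rw [hexp_apply]
      simp [dirichletMonomial, cpow_def_of_ne_zero hk0]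
    exact hℓV _ (this ▸ hmono _)
  have hzero : F =ᶠ[𝓝 0] fun _ ↦ 0 := by
    filter_upwards [Metric.closedBall_mem_nhds (0 : ℂ) one_pos] with w hw
    exact eq_zero_of_forall_log_eq_zero hF hA h0 (mem_closedBall_zero_iff.1 hw)
  have h1 := (hexp 0).unique ((hasDerivAt_const (0 : ℂ) (0 : ℂ)).congr_of_eventuallyEq hzero)
  rw [zero_smul, NormedSpace.exp_zero, one_mul, map_neg, neg_eq_zero] at h1
  exact hℓX h1

end Dirichlet

section Symmetrization

theorem exists_continuous_hasCompactSupport_eqOn {K : Set ℂ} (hK : IsCompact K) {f : ℂ → ℂ}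
    (hf : ContinuousOn f K) : ∃ F : ℂ → ℂ, Continuous F ∧ HasCompactSupport F ∧ EqOn F f K := by
  obtain ⟨g, hg⟩ := ContinuousMap.exists_restrict_eq hK.isClosed
    (⟨K.domRestrict f, hf.domRestrict⟩ : C(K, ℂ))
  obtain ⟨χ, hχ, -, hχc, -⟩ :=
    exists_continuous_one_zero_of_isCompact hK isClosed_empty (disjoint_empty K)
  refine ⟨fun z ↦ χ z • g z, by fun_prop, hχc.smul_right, fun z hz ↦ ?_⟩
  simpa [hχ hz] using DFunLike.congr_fun hg ⟨z, hz⟩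

theorem IsDirichletPolynomial.exists_symmetrization {D : ℂ → ℂ} (hD : IsDirichletPolynomial D) :
    ∃ E : ℂ → ℂ, IsDirichletPolynomial E ∧
      (∀ z, E (starRingEnd ℂ z) = starRingEnd ℂ (E z)) ∧
      ∀ z, E z = (D z + starRingEnd ℂ (D (starRingEnd ℂ z))) / 2 := by
  obtain ⟨m, a, hD⟩ := hD
  have hconj : ∀ z, starRingEnd ℂ (D (starRingEnd ℂ z)) =
      ∑ k ∈ Finset.Icc 1 m, starRingEnd ℂ (a k) * (k : ℂ) ^ (-z) := fun z ↦ by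
    rw [hD, map_sum]
    refine Finset.sum_congr rfl fun k _ ↦ ?_
    have harg : (k : ℂ).arg ≠ Real.pi := by
      rw [natCast_arg]
      exact Real.pi_ne_zero.symm
    rw [map_mul, ← map_neg, cpow_conj _ _ harg, conj_conj, conj_natCast]
  refine ⟨fun z ↦ (D z + starRingEnd ℂ (D (starRingEnd ℂ z))) / 2,
    ⟨m, fun k ↦ (a k + starRingEnd ℂ (a k)) / 2, fun z ↦ ?_⟩, fun z ↦ ?_, fun z ↦ rfl⟩
  · beta_reduce
    rw [hconj, hD, ← Finset.sum_add_distrib, Finset.sum_div]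
    exact Finset.sum_congr rfl fun k _ ↦ by ring
  · have h2 : starRingEnd ℂ 2 = 2 := map_ofNat _ 2
    simp [add_comm, h2]

end Symmetrization

/-- If `K ⊆ ℂ` is a real-symmetric compact set with connected complement, then every
real-symmetric function continuous on `K` and holomorphic on the interior of `K` can be
uniformly approximated on `K` by real-symmetric Dirichlet polynomials. -/
theorem symmetric_dirichlet_approx (K : Set ℂ) (hK : IsCompact K)
    (hsym : (starRingEnd ℂ) '' K = K) (hc : IsConnected Kᶜ)
    (f : ℂ → ℂ) (hfc : ContinuousOn f K) (hfd : DifferentiableOn ℂ f (interior K))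
    (hfsym : ∀ z ∈ K, f z = starRingEnd ℂ (f (starRingEnd ℂ z))) :
    ∀ ε > 0, ∃ D : ℂ → ℂ, IsDirichletPolynomial D ∧
      (∀ z : ℂ, D (starRingEnd ℂ z) = starRingEnd ℂ (D z)) ∧
      ∀ z ∈ K, ‖f z - D z‖ < ε := by
  intro ε hε
  have : CompactSpace K := isCompact_iff_compactSpace.1 hK
  obtain ⟨F, hF, hFc, hFf⟩ := exists_continuous_hasCompactSupport_eqOn hK hfc
  have hmem : (⟨fun z ↦ F z, by fun_prop⟩ : C(K, ℂ)) ∈ (dirichletAlgebra K).topologicalClosure :=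
    mem_of_differentiableOn_interior (Subalgebra.isClosed_topologicalClosure _)
      coordinate_mem_topologicalClosure_dirichletAlgebra hc.isPreconnected hF hFc
      (hfd.congr fun z hz ↦ hFf (interior_subset hz)) fun _ ↦ rfl
  obtain ⟨φ, hφ, hφF⟩ := Metric.mem_closure_iff.1 hmem ε hε
  obtain ⟨D, hD, hφD⟩ := exists_isDirichletPolynomial_of_mem hφ
  obtain ⟨E, hE, hEsym, hED⟩ := hD.exists_symmetrization
  have hfD : ∀ z ∈ K, ‖f z - D z‖ < ε := fun z hz ↦ by
    rw [← hFf hz, ← hφD ⟨z, hz⟩, ← dist_eq_norm]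
    exact (ContinuousMap.dist_apply_le_dist (⟨z, hz⟩ : K)).trans_lt hφF
  refine ⟨E, hE, hEsym, fun z hz ↦ ?_⟩
  have h1 := hfD z hz
  have h2 := hfD (starRingEnd ℂ z) (hsym ▸ mem_image_of_mem _ hz)
  rw [← norm_conj, map_sub, ← hfsym z hz] at h2
  calc ‖f z - E z‖
      = ‖(f z - D z) + (f z - starRingEnd ℂ (D (starRingEnd ℂ z)))‖ / 2 := by
        rw [← Complex.norm_ofNat 2, ← norm_div, hED]
        congr 1
        ring
    _ ≤ (‖f z - D z‖ + ‖f z - starRingEnd ℂ (D (starRingEnd ℂ z))‖) / 2 := by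
        gcongr
        exact norm_add_le _ _
    _ < ε := by linarith
end

section
/- Let K be a real-symmetric compact subset of ℂ with ℂ \ K connected, let f be a real-symmetric function holomorphic on an open neighbourhood of K, let a_1, …, a_m ∈ K, let k ∈ ℕ, and let ε > 0. Then there exists a real-symmetric algebraic polynomial P such that |f(z) − P(z)| < ε for all z ∈ K, P(a_j) = f(a_j) for all j, and moreover P^{(ℓ)}(a_j) = f^{(ℓ)}(a_j) for ℓ = 0, 1, …, k whenever a_j lies in the interior of K. -/
open Complex Set
open MeasureTheory Filter Topology

/-- Twice the Wirtinger derivative of `u` with respect to `conj z`. -/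
noncomputable def twoDbar (u : ℂ → ℂ) (w : ℂ) : ℂ :=
  fderiv ℝ u w 1 + I * fderiv ℝ u w I

/-- A real-linear map of `ℂ` splits off its conjugate-linear part. -/
lemma clm_add_I_mul (L : ℂ →L[ℝ] ℂ) (v : ℂ) :
    L v + I * L (I * v) = (L 1 + I * L I) * starRingEnd ℂ v := by
  have h1 : L v = v.re * L 1 + v.im * L I := by
    conv_lhs => rw [show v = v.re • (1 : ℂ) + v.im • I by simp]
    rw [map_add, map_smul, map_smul]; simp
  have h2 : L (I * v) = v.re * L I - v.im * L 1 := by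
    conv_lhs => rw [show I * v = v.re • I - v.im • (1 : ℂ) by
      apply Complex.ext <;> simp]
    rw [map_sub, map_smul, map_smul]; simp
  rw [h1, h2, show starRingEnd ℂ v = v.re - v.im * I by apply Complex.ext <;> simp]
  ring_nf
  rw [I_sq]; ring

lemma continuous_twoDbar {u : ℂ → ℂ} (hu : ContDiff ℝ 1 u) : Continuous (twoDbar u) := by
  have := hu.continuous_fderiv one_ne_zero
  unfold twoDbar
  fun_prop

lemma hasCompactSupport_twoDbar {u : ℂ → ℂ} (hu : HasCompactSupport u) :
    HasCompactSupport (twoDbar u) := by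
  refine (hu.fderiv ℝ).mono fun w hw h => hw ?_
  simp [twoDbar, h]

lemma twoDbar_eq_zero {u : ℂ → ℂ} {w : ℂ} (hu : DifferentiableAt ℂ u w) : twoDbar u w = 0 := by
  have : fderiv ℝ u w = (fderiv ℂ u w).restrictScalars ℝ := hu.fderiv_restrictScalars ℝ
  have h2 : fderiv ℂ u w I = I * fderiv ℂ u w 1 := by
    rw [← smul_eq_mul, ← map_smul]; simp
  simp [twoDbar, this, h2, ← mul_assoc]

/-- A continuous function on the plane vanishing for large first coordinate is integrable on the
target of the polar coordinates. -/
lemma integrableOn_polarCoord_target {g : ℝ × ℝ → ℂ} (hg : Continuous g) {R : ℝ}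
    (hR : ∀ p : ℝ × ℝ, R < p.1 → g p = 0) :
    IntegrableOn g (Ioi 0 ×ˢ Ioo (-Real.pi) Real.pi) := by
  have h : IntegrableOn g (Icc 0 R ×ˢ Icc (-Real.pi) Real.pi) :=
    hg.continuousOn.integrableOn_compact (isCompact_Icc.prod isCompact_Icc)
  refine h.of_forall_sdiff_eq_zero (measurableSet_Ioi.prod measurableSet_Ioo) fun p hp => hR p ?_
  by_contra! hle
  exact hp.2 ⟨⟨hp.1.1.le, hle⟩, Ioo_subset_Icc_self hp.1.2⟩

/-- **Cauchy–Pompeiu formula** at the origin, for compactly supported functions. -/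
lemma integral_twoDbar_div (u : ℂ → ℂ) (hu : ContDiff ℝ 1 u) (hc : HasCompactSupport u) :
    ∫ w, twoDbar u w / w = -(2 * Real.pi) * u 0 := by
  obtain ⟨R, hR⟩ : ∃ R : ℝ, ∀ w : ℂ, R < ‖w‖ → u w = 0 ∧ fderiv ℝ u w = 0 := by
    obtain ⟨R, hR⟩ := hc.isCompact.isBounded.subset_closedBall 0
    refine ⟨R, fun w hw => ?_⟩
    have : w ∉ tsupport u := fun h => hw.not_ge (by simpa using hR h)
    exact ⟨image_eq_zero_of_notMem_tsupport this,
      image_eq_zero_of_notMem_tsupport fun h => this (tsupport_fderiv_subset ℝ h)⟩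
  set e : ℝ → ℂ := fun θ => Real.cos θ + Real.sin θ * I with he
  have hne : ∀ θ, ‖e θ‖ = 1 := fun θ => by
    simp [he, Complex.norm_cos_add_sin_mul_I]
  have hece : Continuous e := by fun_prop
  have hde : ∀ θ, HasDerivAt e (I * e θ) θ := fun θ => by
    have h1 := (Real.hasDerivAt_cos θ).ofReal_comp
    have h2 := (Real.hasDerivAt_sin θ).ofReal_comp.mul_const I
    refine (h1.add h2).congr_deriv ?_
    simp only [he]; push_cast; ring_nf; rw [I_sq]; ring
  have hfd := hu.continuous_fderiv one_ne_zero
  have hdu : ∀ w, HasFDerivAt u (fderiv ℝ u w) w := fun w =>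
    (hu.differentiable one_ne_zero w).hasFDerivAt
  have hlarge : ∀ r θ : ℝ, R < r → R < ‖(r : ℂ) * e θ‖ := fun r θ h => by
    rw [norm_mul, hne, mul_one]; simpa using h.trans_le (le_abs_self r)
  set A : ℝ × ℝ → ℂ := fun p => fderiv ℝ u (p.1 * e p.2) (e p.2) with hA
  set B : ℝ × ℝ → ℂ := fun p => fderiv ℝ u (p.1 * e p.2) (I * e p.2) with hB
  have hAc : Continuous A := by fun_prop
  have hBc : Continuous B := by fun_prop
  have hAi := integrableOn_polarCoord_target hAc (R := R) fun p hp => by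
    simp [hA, (hR _ (hlarge _ p.2 hp)).2]
  have hBi := integrableOn_polarCoord_target hBc (R := R) fun p hp => by
    simp [hB, (hR _ (hlarge _ p.2 hp)).2]
  have hAint : ∫ p in Ioi (0 : ℝ) ×ˢ Ioo (-Real.pi) Real.pi, A p = -(2 * Real.pi) * u 0 := by
    rw [Measure.volume_eq_prod, ← setIntegral_prod_swap,
      setIntegral_prod (fun p : ℝ × ℝ => A p.swap) hAi.swap]
    have hin : ∀ θ : ℝ, ∫ r in Ioi (0 : ℝ), A (r, θ) = - u 0 := fun θ => by
      rw [integral_Ioi_of_hasDerivAt_of_tendsto' (f := fun r : ℝ => u (r * e θ)) (m := 0)]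
      · simp
      · intro r _
        have : HasDerivAt (fun r : ℝ => (r : ℂ) * e θ) (e θ) r := by
          simpa using (hasDerivAt_id r).ofReal_comp.mul_const (e θ)
        exact (hdu _).comp_hasDerivAt r this
      · have h : IntegrableOn (fun r => A (r, θ)) (Icc 0 R) :=
          (by fun_prop : Continuous fun r => A (r, θ)).continuousOn.integrableOn_compact
            isCompact_Icc
        refine h.of_forall_sdiff_eq_zero measurableSet_Ioi fun r hr => ?_
        have : R < r := by
          by_contra! hle
          exact hr.2 ⟨le_of_lt hr.1, hle⟩
        simp [hA, (hR _ (hlarge _ θ this)).2]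
      · refine tendsto_const_nhds.congr' ?_
        filter_upwards [eventually_gt_atTop R] with r hr
        exact (hR _ (hlarge _ θ hr)).1.symm
    simp only [Prod.swap_prod_mk, hin]
    have hpi : (Real.pi : ℂ) + Real.pi = 2 * Real.pi := by ring
    simp [Real.pi_pos.le, hpi]
  have hBint : ∫ p in Ioi (0 : ℝ) ×ˢ Ioo (-Real.pi) Real.pi, B p = 0 := by
    rw [Measure.volume_eq_prod, setIntegral_prod _ hBi]
    refine setIntegral_eq_zero_of_forall_eq_zero fun r (hr : 0 < r) => ?_
    rw [← integral_Ioc_eq_integral_Ioo,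
      ← intervalIntegral.integral_of_le (by linarith [Real.pi_pos])]
    have hr' : (r : ℂ) ≠ 0 := by exact_mod_cast hr.ne'
    have := intervalIntegral.integral_eq_sub_of_hasDerivAt (a := -Real.pi) (b := Real.pi)
      (f := fun θ : ℝ => (r : ℂ)⁻¹ * u (r * e θ)) (f' := fun θ => B (r, θ)) (fun θ _ => by
        have h1 := (hdu (r * e θ)).comp_hasDerivAt θ ((hde θ).const_mul (r : ℂ))
        refine (h1.const_mul (r : ℂ)⁻¹).congr_deriv ?_
        rw [← real_smul (z := I * e θ), map_smul, real_smul, inv_mul_cancel_left₀ hr'])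
      ((by fun_prop : Continuous fun θ => B (r, θ)).intervalIntegrable _ _)
    rw [this]
    simp [he]
  rw [← Complex.integral_comp_polarCoord_symm]
  have : ∫ p in polarCoord.target, p.1 • (twoDbar u (Complex.polarCoord.symm p) /
      Complex.polarCoord.symm p) =
      ∫ p in Ioi (0 : ℝ) ×ˢ Ioo (-Real.pi) Real.pi, (A p + I * B p) := by
    refine setIntegral_congr_fun (measurableSet_Ioi.prod measurableSet_Ioo) fun p hp => ?_
    have hp' : (p.1 : ℂ) ≠ 0 := by exact_mod_cast (ne_of_gt hp.1)
    have hep : e p.2 ≠ 0 := norm_ne_zero_iff.1 (by simp [hne])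
    have hcj : starRingEnd ℂ (e p.2) = (e p.2)⁻¹ := by
      rw [Complex.inv_def, normSq_eq_norm_sq, hne]; simp
    simp only [Complex.polarCoord_symm_apply, hA, hB]
    rw [clm_add_I_mul, hcj, real_smul]
    change _ * (twoDbar u (p.1 * e p.2) / (p.1 * e p.2)) = twoDbar u (p.1 * e p.2) * _
    field_simp
  rw [this, integral_add hAi (hBi.const_mul I), integral_const_mul, hAint, hBint]
  simp

/-- **Cauchy–Pompeiu formula** for compactly supported functions. -/
lemma integral_twoDbar_div_sub (u : ℂ → ℂ) (hu : ContDiff ℝ 1 u) (hc : HasCompactSupport u)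
    (z : ℂ) : ∫ w, twoDbar u w / (w - z) = -(2 * Real.pi) * u z := by
  have h := integral_twoDbar_div (fun w => u (w + z)) (by fun_prop)
    (hc.comp_homeomorph (Homeomorph.addRight z))
  rw [zero_add] at h
  rw [← h, ← integral_add_right_eq_self _ z]
  congr 1 with w
  simp [twoDbar, fderiv_comp_add_right]

/-- A differentiable function can be multiplied by a cutoff equal to one near a compact set. -/
lemma exists_contDiff_hasCompactSupport_eqOn {K V : Set ℂ} (hK : IsCompact K) (hV : IsOpen V)
    (hKV : K ⊆ V) {f : ℂ → ℂ} (hf : DifferentiableOn ℂ f V) :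
    ∃ u : ℂ → ℂ, ContDiff ℝ 1 u ∧ HasCompactSupport u ∧ ∀ᶠ z in 𝓝ˢ K, u z = f z := by
  obtain ⟨T, hT, hKT, hTV⟩ := exists_compact_between hK hV hKV
  obtain ⟨φ, h1, h0, -⟩ := exists_contMDiffMap_one_nhds_of_subset_interior (n := 1)
    (modelWithCornersSelf ℝ ℂ) hK.isClosed hKT
  have hφ : ContDiff ℝ 1 φ := φ.contMDiff.contDiff
  have hsub : tsupport φ ⊆ T := closure_minimal (fun x hx => by
    by_contra h; exact hx (h0 x h)) hT.isClosed
  refine ⟨fun z => φ z • f z, ?_, ?_, ?_⟩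
  · rw [contDiff_iff_contDiffAt]
    intro z
    by_cases hz : z ∈ V
    · have : ContDiffAt ℂ 1 f z := (hf.analyticAt (hV.mem_nhds hz)).contDiffAt
      exact hφ.contDiffAt.smul (this.restrict_scalars ℝ)
    · have hz' : z ∉ tsupport φ := fun h => hz (hTV (hsub h))
      refine (contDiffAt_const (c := (0 : ℂ))).congr_of_eventuallyEq ?_
      filter_upwards [notMem_tsupport_iff_eventuallyEq.1 hz'] with w hw
      simp [hw]
  · exact HasCompactSupport.intro hT fun x hx => by simp [h0 x hx]
  · filter_upwards [h1] with z hz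
    simp [hz]

/-- In the uniform closure of the polynomials on a compact set `K` with connected complement, the
coordinate function has spectrum `K`. -/
lemma spectrum_topologicalClosure_polynomialFunctions {K : Set ℂ} [CompactSpace K]
    (hc : IsPreconnected Kᶜ)
    (x : (polynomialFunctions K).topologicalClosure)
    (hx : (x : C(K, ℂ)) = Polynomial.X.toContinuousMapOn K) :
    spectrum ℂ x = K := by
  have hs : spectrum ℂ (x : C(K, ℂ)) = K := by
    rw [ContinuousMap.spectrum_eq_range, hx]
    ext z; simp
  have : IsClosed ((polynomialFunctions K).topologicalClosure : Set C(K, ℂ)) :=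
    Subalgebra.isClosed_topologicalClosure _
  rw [Subalgebra.spectrum_eq_of_isPreconnected_compl _ x (by rwa [hs]), hs]

/-- Dividing by finitely many linear factors. -/
lemma exists_eq_add_prod_mul {V : Set ℂ} (hV : IsOpen V) {f : ℂ → ℂ} (hf : DifferentiableOn ℂ f V)
    (s : Multiset ℂ) (hs : ∀ a ∈ s, a ∈ V) :
    ∃ (H : Polynomial ℂ) (g : ℂ → ℂ), DifferentiableOn ℂ g V ∧
      ∀ z, f z = H.eval z + (s.map fun a => z - a).prod * g z := by
  induction s using Multiset.induction_on with
  | empty => exact ⟨0, f, hf, by simp⟩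
  | cons a s ih =>
    obtain ⟨H, g, hg, h⟩ := ih fun b hb => hs b (Multiset.mem_cons_of_mem hb)
    have ha : V ∈ 𝓝 a := hV.mem_nhds (hs a (Multiset.mem_cons_self a s))
    refine ⟨H + (s.map fun a => Polynomial.X - Polynomial.C a).prod * Polynomial.C (g a),
      dslope g a, (differentiableOn_dslope ha).2 hg, fun z => ?_⟩
    have hd := sub_smul_dslope g a z
    rw [smul_eq_mul] at hd
    simp only [h z, Multiset.map_cons, Multiset.prod_cons, Polynomial.eval_add,
      Polynomial.eval_mul, Polynomial.eval_C, Polynomial.eval_multiset_prod, Multiset.map_map,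
      Function.comp_def, Polynomial.eval_sub, Polynomial.eval_X]
    linear_combination (-(s.map fun a => z - a).prod) * hd

/-- Holomorphic functions whose difference vanishes to order `n` at `a` have the same derivatives of
order less than `n` at `a`. -/
lemma iteratedDeriv_eq_of_sub_eq_pow_mul {V : Set ℂ} (hV : IsOpen V) {f p h : ℂ → ℂ}
    (hf : DifferentiableOn ℂ f V) (hp : DifferentiableOn ℂ p V) (hh : DifferentiableOn ℂ h V)
    {a : ℂ} (ha : a ∈ V) {n : ℕ} (heq : ∀ z ∈ V, f z - p z = (z - a) ^ n * h z)
    {i : ℕ} (hi : i < n) : iteratedDeriv i p a = iteratedDeriv i f a := by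
  have hVa := hV.mem_nhds ha
  have hfa := hf.analyticAt hVa
  have hpa := hp.analyticAt hVa
  have hord : (n : ℕ∞) ≤ analyticOrderAt (f - p) a := by
    rw [natCast_le_analyticOrderAt (hfa.sub hpa)]
    refine ⟨h, hh.analyticAt hVa, ?_⟩
    filter_upwards [hVa] with z hz
    simpa using heq z hz
  have := (natCast_le_analyticOrderAt_iff_iteratedDeriv_eq_zero (hfa.sub hpa)).1 hord i hi
  rw [iteratedDeriv_sub hfa.contDiffAt hpa.contDiffAt] at this
  exact (sub_eq_zero.1 this).symm

/-- **Runge's theorem** for polynomials: a function holomorphic near a compact set with connected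
complement is a uniform limit of polynomials on it. -/
theorem exists_polynomial_norm_sub_lt {K V : Set ℂ} (hK : IsCompact K) (hc : IsPreconnected Kᶜ)
    (hV : IsOpen V) (hKV : K ⊆ V) {f : ℂ → ℂ} (hf : DifferentiableOn ℂ f V) {ε : ℝ} (hε : 0 < ε) :
    ∃ P : Polynomial ℂ, ∀ z ∈ K, ‖f z - P.eval z‖ < ε := by
  have : CompactSpace K := isCompact_iff_compactSpace.1 hK
  obtain ⟨u, hu, huc, huf⟩ := exists_contDiff_hasCompactSupport_eqOn hK hV hKV hf
  let S := (polynomialFunctions K).topologicalClosure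
  have hS : IsClosed (S : Set C(K, ℂ)) := Subalgebra.isClosed_topologicalClosure _
  have : CompleteSpace S := hS.completeSpace_coe
  let x : S := ⟨Polynomial.X.toContinuousMapOn K, Subalgebra.le_topologicalClosure _
    ⟨Polynomial.X, trivial, rfl⟩⟩
  have hspec : spectrum ℂ x = K := spectrum_topologicalClosure_polynomialFunctions hc x rfl
  have hres : ∀ w ∉ K, w ∈ resolventSet ℂ x := fun w hw => by
    rwa [← hspec, spectrum.notMem_iff] at hw
  have hzero : ∀ w ∈ K, ∀ᶠ y in 𝓝 w, twoDbar u y = 0 := fun w hw => by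
    obtain ⟨O, hO, hKO, hOf⟩ := mem_nhdsSet_iff_exists.1 huf
    filter_upwards [hO.mem_nhds (hKO hw), hV.mem_nhds (hKV hw)] with y hyO hyV
    refine twoDbar_eq_zero ((hf.differentiableAt (hV.mem_nhds hyV)).congr_of_eventuallyEq ?_)
    filter_upwards [hO.mem_nhds hyO] with y' hy' using hOf hy'
  let G : ℂ → S := fun w => twoDbar u w • resolvent x w
  have hGc : Continuous G := continuous_iff_continuousAt.2 fun w => by
    by_cases hw : w ∈ K
    · refine (continuousAt_const (y := (0 : S))).congr ?_
      filter_upwards [hzero w hw] with y hy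
      simp [G, hy]
    · exact (continuous_twoDbar hu).continuousAt.smul
        (spectrum.hasDerivAt_resolvent_const_left (hres w hw)).continuousAt
  have hGs : HasCompactSupport G := (hasCompactSupport_twoDbar huc).smul_right
  have hGi : Integrable G := hGc.integrable_of_hasCompactSupport hGs
  let F : S := (-(2 * Real.pi : ℂ))⁻¹ • ∫ w, G w
  have hF : ∀ z : K, (F : C(K, ℂ)) z = f z := fun z => by
    let ev : S →L[ℂ] ℂ := (ContinuousMap.evalCLM ℂ z).comp S.toSubmodule.subtypeL
    have hpi : -(2 * Real.pi : ℂ) ≠ 0 := by simp [Real.pi_ne_zero]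
    have hG : ∀ w, ev (G w) = twoDbar u w / (w - z) := fun w => by
      by_cases hw : w ∈ K
      · simp [G, (hzero w hw).self_of_nhds]
      · have h1 : (algebraMap ℂ S w - x) * resolvent x w = 1 :=
          Ring.mul_inverse_cancel _ (hres w hw)
        have h2 := congr_arg (fun y : S => (y : C(K, ℂ)) z) h1
        have h3 : (w - z) * ((resolvent x w : S) : C(K, ℂ)) z = 1 := by
          simpa [x] using h2
        have h4 : w - z ≠ 0 := left_ne_zero_of_mul_eq_one h3
        change twoDbar u w * ((resolvent x w : S) : C(K, ℂ)) z = _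
        rw [eq_div_iff h4, mul_assoc, mul_comm _ (w - (z : ℂ)), h3, mul_one]
    change ev F = _
    rw [map_smul, ← ev.integral_comp_comm hGi, integral_congr_ae (.of_forall hG),
      integral_twoDbar_div_sub u hu huc, smul_eq_mul, inv_mul_cancel_left₀ hpi]
    exact huf.self_of_nhdsSet z z.2
  obtain ⟨_, ⟨P, -, rfl⟩, hP⟩ := Metric.mem_closure_iff.1 F.2 ε hε
  refine ⟨P, fun z hz => ?_⟩
  have h := ContinuousMap.dist_lt_iff hε |>.1 hP ⟨z, hz⟩
  rw [hF, dist_eq_norm] at h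
  exact h

/-- Simultaneous approximation and Hermite interpolation by polynomials. -/
lemma exists_polynomial_norm_sub_lt_and_eq_pow_mul {K V : Set ℂ} (hK : IsCompact K)
    (hc : IsPreconnected Kᶜ) (hV : IsOpen V) (hKV : K ⊆ V) {f : ℂ → ℂ}
    (hf : DifferentiableOn ℂ f V) {ι : Type*} [Fintype ι] (a : ι → ℂ) (ha : ∀ j, a j ∈ V) (n : ℕ)
    {ε : ℝ} (hε : 0 < ε) :
    ∃ P : Polynomial ℂ, (∀ z ∈ K, ‖f z - P.eval z‖ < ε) ∧
      ∀ j, ∃ h : ℂ → ℂ, DifferentiableOn ℂ h V ∧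
        ∀ z, f z - P.eval z = (z - a j) ^ n * h z := by
  classical
  obtain ⟨H, g, hg, hfg⟩ := exists_eq_add_prod_mul hV hf (n • Finset.univ.val.map a)
    fun b hb => by
      obtain ⟨j, -, rfl⟩ := Multiset.mem_map.1 (Multiset.mem_of_mem_nsmul hb)
      exact ha j
  have hprod : ∀ z, ((n • Finset.univ.val.map a).map fun b => z - b).prod =
      (∏ j, (z - a j)) ^ n := fun z => by
    rw [Multiset.map_nsmul, Multiset.prod_nsmul, Multiset.map_map]; rfl
  simp only [hprod] at hfg
  obtain ⟨M, hM⟩ := hK.exists_bound_of_continuousOn (f := fun z => (∏ j, (z - a j)) ^ n)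
    (by fun_prop)
  obtain ⟨R, hR⟩ := exists_polynomial_norm_sub_lt hK hc hV hKV hg (ε := ε / (|M| + 1))
    (by positivity)
  let P := H + (∏ j, (Polynomial.X - Polynomial.C (a j))) ^ n * R
  have hP : ∀ z, f z - P.eval z = (∏ j, (z - a j)) ^ n * (g z - R.eval z) := fun z => by
    simp only [hfg z, P, Polynomial.eval_add, Polynomial.eval_mul, Polynomial.eval_pow,
      Polynomial.eval_prod, Polynomial.eval_sub, Polynomial.eval_X, Polynomial.eval_C]
    ring
  refine ⟨P, fun z hz => ?_, fun j => ?_⟩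
  · rw [hP, norm_mul]
    calc _ ≤ |M| * ‖g z - R.eval z‖ := by gcongr; exact (hM z hz).trans (le_abs_self M)
      _ ≤ |M| * (ε / (|M| + 1)) := by gcongr; exact (hR z hz).le
      _ < (|M| + 1) * (ε / (|M| + 1)) := by gcongr; linarith
      _ = ε := by field_simp
  · refine ⟨fun z => (∏ i ∈ Finset.univ.erase j, (z - a i)) ^ n * (g z - R.eval z), ?_,
      fun z => ?_⟩
    · have := R.differentiable.differentiableOn (s := V)
      fun_prop
    · rw [hP, ← Finset.mul_prod_erase _ _ (Finset.mem_univ j), mul_pow, mul_assoc]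

/-- Simultaneous approximation and interpolation by real-symmetric polynomials: if `K` is
a real-symmetric compact set with connected complement and `f` is real-symmetric and
holomorphic on an open neighbourhood of `K`, then for any points `a_1, …, a_m ∈ K`, any
`k ∈ ℕ` and any `ε > 0`, there is a real-symmetric polynomial `P` which is `ε`-close to
`f` on `K`, interpolates `f` at the `a_j`, and matches the derivatives of `f` up to order
`k` at those `a_j` lying in the interior of `K`. -/
theorem symmetric_poly_approx_interpolate (K : Set ℂ) (hK : IsCompact K)
    (hsym : (starRingEnd ℂ) '' K = K) (hc : IsConnected Kᶜ)
    (V : Set ℂ) (hV : IsOpen V) (hKV : K ⊆ V) (hVsym : (starRingEnd ℂ) '' V = V)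
    (f : ℂ → ℂ) (hf : DifferentiableOn ℂ f V)
    (hfsym : ∀ z ∈ V, f z = starRingEnd ℂ (f (starRingEnd ℂ z)))
    (m : ℕ) (a : Fin m → ℂ) (haK : ∀ j, a j ∈ K) (k : ℕ) (ε : ℝ) (hε : 0 < ε) :
    ∃ P : Polynomial ℂ,
      (∀ z : ℂ, P.eval (starRingEnd ℂ z) = starRingEnd ℂ (P.eval z)) ∧
      (∀ z ∈ K, ‖f z - P.eval z‖ < ε) ∧
      (∀ j, P.eval (a j) = f (a j)) ∧
      (∀ j, a j ∈ interior K → ∀ ℓ ≤ k,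
        iteratedDeriv ℓ (fun z => P.eval z) (a j) = iteratedDeriv ℓ f (a j)) := by
  have hmem : ∀ z ∈ V, starRingEnd ℂ z ∈ V := fun z hz => hVsym ▸ mem_image_of_mem _ hz
  have hmemK : ∀ z ∈ K, starRingEnd ℂ z ∈ K := fun z hz => hsym ▸ mem_image_of_mem _ hz
  obtain ⟨Q, hQ, hQa⟩ := exists_polynomial_norm_sub_lt_and_eq_pow_mul hK hc.isPreconnected hV hKV
    hf (Sum.elim a fun j => starRingEnd ℂ (a j)) (Sum.rec (fun j => hKV (haK j))
      fun j => hKV (hmemK _ (haK j))) (k + 1) hε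
  let Q' := Q.map (starRingEnd ℂ)
  have hQ' : ∀ z, Q'.eval z = starRingEnd ℂ (Q.eval (starRingEnd ℂ z)) := fun z => by
    simp [Q', ← Polynomial.eval₂_at_apply, Polynomial.eval_map]
  let P := Polynomial.C (2⁻¹ : ℂ) * (Q + Q')
  have hP : ∀ z, P.eval z = 2⁻¹ * (Q.eval z + Q'.eval z) := fun z => by simp [P]
  have hfP : ∀ z ∈ V, f z - P.eval z = 2⁻¹ * ((f z - Q.eval z) +
      starRingEnd ℂ (f (starRingEnd ℂ z) - Q.eval (starRingEnd ℂ z))) := fun z hz => by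
    rw [map_sub, ← hfsym z hz, hP, hQ']; ring
  have key : ∀ j, ∃ h : ℂ → ℂ, DifferentiableOn ℂ h V ∧
      ∀ z ∈ V, f z - P.eval z = (z - a j) ^ (k + 1) * h z := fun j => by
    obtain ⟨g, hg, hgQ⟩ := hQa (.inl j)
    obtain ⟨g', hg', hgQ'⟩ := hQa (.inr j)
    refine ⟨fun z => 2⁻¹ * (g z + starRingEnd ℂ (g' (starRingEnd ℂ z))), ?_, fun z hz => ?_⟩
    · have : DifferentiableOn ℂ (fun z => starRingEnd ℂ (g' (starRingEnd ℂ z))) V := fun z hz =>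
        DifferentiableAt.differentiableWithinAt <| by
          have := (hg'.differentiableAt (hV.mem_nhds (hmem z hz))).conj_conj
          rwa [Complex.conj_conj] at this
      fun_prop
    · rw [hfP z hz, hgQ, hgQ']
      simp only [Sum.elim_inl, Sum.elim_inr, map_mul, map_pow, map_sub, Complex.conj_conj]
      ring
  refine ⟨P, fun z => ?_, fun z hz => ?_, fun j => ?_, fun j _ ℓ hℓ => ?_⟩
  · simp only [hP, hQ', map_mul, map_add, Complex.conj_conj, map_inv₀, map_ofNat]
    ring
  · rw [hfP z (hKV hz), norm_mul]
    have h1 := norm_add_le (f z - Q.eval z)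
      (starRingEnd ℂ (f (starRingEnd ℂ z) - Q.eval (starRingEnd ℂ z)))
    rw [RCLike.norm_conj] at h1
    have h2 := hQ z hz
    have h3 := hQ _ (hmemK z hz)
    rw [norm_inv, Complex.norm_ofNat]
    linarith
  · obtain ⟨h, -, hh⟩ := key j
    have := hh _ (hKV (haK j))
    rw [sub_self, zero_pow k.succ_ne_zero, zero_mul, sub_eq_zero] at this
    exact this.symm
  · obtain ⟨h, hd, hh⟩ := key j
    exact iteratedDeriv_eq_of_sub_eq_pow_mul hV hf P.differentiable.differentiableOn hd
      (hKV (haK j)) hh (Nat.lt_succ_of_le hℓ)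
end
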